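/- Under Hypothesis H, with Z a non-negative integer such that Z < n and no row of M has more than Z vanishing entries, the function (s,w) ↦ ζ_{N,n}(s,w,M) has a meromorphic continuation to ℂ × {w ∈ ℂ^n : Re(w_k) > 0, 1 ≤ k ≤ n}; for each such fixed w the function s ↦ ζ_{N,n}(s,w,M) has poles of order at most Z+1, and its poles can occur only at rational numbers s̃ ≤ N/(n − Z) of the form s̃ = a/b with a, b ∈ ℤ and n − Z ≤ b ≤ n. Moreover ζ_{N,n}(s,w,M) is analytic at (−ℓ, w) for every non-negative integer ℓ and every w ∈ ℂ^n with Re(w_k) > 0 (1 ≤ k ≤ n). -/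

import Mathlib

open MeasureTheory Complex
open scoped Classical

noncomputable section

/-- Hypothesis H: each entry of the matrix either vanishes or has positive real part,
and no row vanishes. -/
def HypH {N n : ℕ} (a : Fin N → Fin n → ℂ) : Prop :=
  (∀ i j, a i j = 0 ∨ 0 < (a i j).re) ∧ ∀ i, ∃ j, a i j ≠ 0

/-- The Shintani–Barnes zeta series `ζ_{N,n}(s,w,M)`. -/
def zetaSeries {N n : ℕ} (a : Fin N → Fin n → ℂ) (s : ℂ) (w : Fin n → ℂ) : ℂ :=
  ∑' k : Fin N → ℕ, ∏ j, (w j + ∑ i, (k i : ℂ) * a i j) ^ (-s)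

/-- A continuous family of continuous functions on a compact space which is pointwise holomorphic
is holomorphic for the uniform norm. -/
theorem ContinuousMap.differentiableAt_of_eval {K F : Type*} [TopologicalSpace K] [CompactSpace K]
    [NormedAddCommGroup F] [NormedSpace ℂ F] [CompleteSpace F] {h : ℂ → C(K, F)} {δ : ℝ}
    (hδ : 0 < δ) (hc : ContinuousOn h (Metric.closedBall 0 δ))
    (hd : ∀ x, ∀ t ∈ Metric.closedBall (0 : ℂ) δ, DifferentiableAt ℂ (fun t => h t x) t) :
    DifferentiableAt ℂ h 0 := by
  lift δ to NNReal using hδ.le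
  have hδ' : 0 < δ := by exact_mod_cast hδ
  have hci : CircleIntegrable h 0 δ := by
    apply ContinuousOn.circleIntegrable hδ.le
    exact hc.mono Metric.sphere_subset_closedBall
  have hps := (hasFPowerSeriesOn_cauchy_integral hci hδ').analyticAt.differentiableAt
  refine hps.congr_of_eventuallyEq ?_
  filter_upwards [Metric.ball_mem_nhds (0 : ℂ) hδ] with w hw
  ext x
  have hdc : DiffContOnCl ℂ (fun t => h t x) (Metric.ball 0 δ) := by
    apply DifferentiableOn.diffContOnCl
    intro t ht
    exact (hd x t (Metric.closure_ball_subset_closedBall ht)).differentiableWithinAt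
  have h1 := hdc.circleIntegral_sub_inv_smul hw
  have hcont : ContinuousOn (fun z => (z - w)⁻¹ • h z) (Metric.sphere 0 δ) := by
    refine ContinuousOn.smul (f := fun z => (z - w)⁻¹) (g := h) ?_ ?_
    · apply ContinuousOn.inv₀ (by fun_prop)
      intro z hz hzw
      rw [sub_eq_zero] at hzw
      subst hzw
      rw [Metric.mem_sphere] at hz
      rw [Metric.mem_ball, hz] at hw
      exact lt_irrefl _ hw
    · exact hc.mono Metric.sphere_subset_closedBall
  have h2 : (∮ z in C(0, δ), (z - w)⁻¹ • h z) x = ∮ z in C(0, δ), (z - w)⁻¹ • h z x := by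
    have hI : CircleIntegrable (fun z => (z - w)⁻¹ • h z) 0 δ := hcont.circleIntegrable hδ.le
    have := (ContinuousMap.evalCLM (M := F) ℂ x).intervalIntegral_comp_comm hI.out
    simp only [circleIntegral]
    exact this.symm
  rw [ContinuousMap.smul_apply, h2, h1, smul_smul, inv_mul_cancel₀, one_smul]
  simp [Real.pi_ne_zero]

theorem isFiniteMeasure_comap_Icc (T : ℝ) :
    IsFiniteMeasure (Measure.comap (Subtype.val : Set.Icc 0 T → ℝ) volume) := by
  refine ⟨?_⟩
  have := Measure.Subtype.volume_univ (measurableSet_Icc (a := (0 : ℝ)) (b := T)).nullMeasurableSet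
  rw [← Measure.Subtype.volume_def, this]
  simp

/-- The pairing `(k, G) ↦ ∫ k • G` of continuous functions on a compact interval. -/
def intervalPairing (F : Type*) [NormedAddCommGroup F] [NormedSpace ℂ F] (T : ℝ) :
    C(Set.Icc 0 T, ℂ) →L[ℂ] C(Set.Icc 0 T, F) →L[ℂ] F :=
  have hint : ∀ (k : C(Set.Icc 0 T, ℂ)) (G : C(Set.Icc 0 T, F)),
      Integrable (fun x => k x • G x) (Measure.comap Subtype.val volume) := fun k G =>
    have : IsFiniteMeasure (Measure.comap (Subtype.val : Set.Icc 0 T → ℝ) volume) := by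
      exact isFiniteMeasure_comap_Icc T
    (k.continuous.smul G.continuous).integrable_of_hasCompactSupport
      (HasCompactSupport.of_compactSpace _)
  LinearMap.mkContinuous₂
    (LinearMap.mk₂ ℂ (fun k G => ∫ x, k x • G x ∂(Measure.comap Subtype.val volume))
      (fun k k' G => by
        simp only [ContinuousMap.add_apply, add_smul]
        exact integral_add (hint k G) (hint k' G))
      (fun c k G => by
        simp only [ContinuousMap.smul_apply, smul_assoc]
        exact integral_smul c _)
      (fun k G G' => by
        simp only [ContinuousMap.add_apply, smul_add]
        exact integral_add (hint k G) (hint k G'))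
      (fun c k G => by
        simp only [ContinuousMap.smul_apply]
        rw [← integral_smul]
        congr 1
        ext x
        rw [smul_comm]))
    ((Measure.comap (Subtype.val : Set.Icc 0 T → ℝ) volume).real Set.univ) (fun k G => by
      have : IsFiniteMeasure (Measure.comap (Subtype.val : Set.Icc 0 T → ℝ) volume) := by
        exact isFiniteMeasure_comap_Icc T
      simp only [LinearMap.mk₂_apply]
      have := norm_integral_le_of_norm_le_const
        (μ := Measure.comap (Subtype.val : Set.Icc 0 T → ℝ) volume)
        (f := fun x => k x • G x) (C := ‖k‖ * ‖G‖) (Filter.Eventually.of_forall fun x => by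
          rw [norm_smul]
          exact mul_le_mul (k.norm_coe_le_norm x) (G.norm_coe_le_norm x) (norm_nonneg _)
            (norm_nonneg _))
      calc _ ≤ _ := this
        _ = _ := by ring)

theorem intervalPairing_apply {F : Type*} [NormedAddCommGroup F] [NormedSpace ℂ F] (T : ℝ)
    (k : C(Set.Icc 0 T, ℂ)) (G : C(Set.Icc 0 T, F)) :
    intervalPairing F T k G = ∫ x, k x • G x ∂(Measure.comap Subtype.val volume) := rfl

/-- Continuity near `p₀` together with complex differentiability along every complex line. -/
def LineHolomorphicNear {E F : Type*} [NormedAddCommGroup E] [NormedSpace ℂ E]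
    [NormedAddCommGroup F] [NormedSpace ℂ F] (f : E → F) (p₀ : E) : Prop :=
  ∀ᶠ p in nhds p₀, ContinuousAt f p ∧ ∀ v, DifferentiableAt ℂ (fun t : ℂ => f (p + t • v)) 0

theorem LineHolomorphicNear.analyticAt_prod {E : Type*} [NormedAddCommGroup E] [NormedSpace ℂ E]
    {F : Type*} [NormedAddCommGroup F] [NormedSpace ℂ F] [CompleteSpace F]
    (hE : ∀ (g : E → C(Set.Icc 0 (2 * Real.pi), F)) (e₀ : E), LineHolomorphicNear g e₀ →
      AnalyticAt ℂ g e₀)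
    {f : ℂ × E → F} {p₀ : ℂ × E} (hf : LineHolomorphicNear f p₀) : AnalyticAt ℂ f p₀ := by
  obtain ⟨z₀, e₀⟩ := p₀
  obtain ⟨R, hR, hball⟩ := Metric.eventually_nhds_iff_ball.1 hf
  set r := R / 2 with hr
  have hr0 : 0 < r := by positivity
  have hmem : ∀ z ∈ Metric.closedBall z₀ r, ∀ e ∈ Metric.ball e₀ R,
      (z, e) ∈ Metric.ball (z₀, e₀) R := by
    intro z hz e he
    rw [← ball_prod_same]
    refine ⟨?_, he⟩
    rw [Metric.mem_closedBall] at hz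
    rw [Metric.mem_ball]
    linarith
  have hcirc : ∀ θ : ℝ, circleMap z₀ r θ ∈ Metric.closedBall z₀ r := fun θ =>
    circleMap_mem_closedBall z₀ hr0.le θ
  set K := Set.Icc 0 (2 * Real.pi)
  have hcont : ∀ e ∈ Metric.ball e₀ R, Continuous fun θ : K => f (circleMap z₀ r θ, e) := by
    intro e he
    rw [continuous_iff_continuousAt]
    intro θ
    refine ContinuousAt.comp (f := fun θ : K => (circleMap z₀ r θ, e))
      (hball _ (hmem _ (hcirc θ) e he)).1 ?_
    have := (continuous_circleMap z₀ r)
    fun_prop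
  set g : E → C(K, F) := fun e => if he : e ∈ Metric.ball e₀ R then ⟨_, hcont e he⟩ else 0 with hg
  have hgv : ∀ e ∈ Metric.ball e₀ R, ∀ θ : K, g e θ = f (circleMap z₀ r θ, e) := by
    intro e he θ
    simp only [hg, dif_pos he, ContinuousMap.coe_mk]
  have hgc : ContinuousOn g (Metric.ball e₀ R) := by
    rw [continuousOn_iff_continuous_domRestrict]
    apply ContinuousMap.continuous_of_continuous_uncurry
    have : (Function.uncurry fun (x : Metric.ball e₀ R) (y : K) => (Set.domRestrict _ g x) y) =
        fun q : Metric.ball e₀ R × K => f (circleMap z₀ r q.2, q.1) := by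
      ext ⟨e, θ⟩
      exact hgv e e.2 θ
    rw [this, continuous_iff_continuousAt]
    intro q
    refine ContinuousAt.comp (f := fun q : Metric.ball e₀ R × K => (circleMap z₀ r q.2, (q.1 : E)))
      (hball _ (hmem _ (hcirc q.2) q.1 q.1.2)).1 ?_
    have := (continuous_circleMap z₀ r)
    fun_prop
  have hgL : LineHolomorphicNear g e₀ := by
    filter_upwards [Metric.isOpen_ball.mem_nhds (Metric.mem_ball_self hR)] with e he
    refine ⟨hgc.continuousAt (Metric.isOpen_ball.mem_nhds he), fun v => ?_⟩
    have hline : Continuous fun t : ℂ => e + t • v := by fun_prop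
    have : (fun t : ℂ => e + t • v) ⁻¹' Metric.ball e₀ R ∈ nhds (0 : ℂ) := by
      apply (Metric.isOpen_ball.preimage hline).mem_nhds
      simpa using he
    obtain ⟨δ, hδ, hδs⟩ := Metric.nhds_basis_closedBall.mem_iff.1 this
    refine ContinuousMap.differentiableAt_of_eval hδ (hgc.comp hline.continuousOn hδs) ?_
    intro θ t ht
    have h0 := (hball _ (hmem _ (hcirc θ) _ (hδs ht))).2 (0, v)
    have h1 : DifferentiableAt ℂ (fun u : ℂ => f (circleMap z₀ r θ, e + u • v)) t := by
      have h2 : DifferentiableAt ℂ (fun u : ℂ => u - t) t := by fun_prop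
      have h3 := DifferentiableAt.comp t (by simpa using h0) h2
      refine h3.congr_of_eventuallyEq (Filter.Eventually.of_forall fun u => ?_)
      simp only [Function.comp_apply]
      congr 2
      rw [sub_smul]
      abel
    refine h1.congr_of_eventuallyEq ?_
    filter_upwards [(Metric.isOpen_ball.preimage hline).mem_nhds (hδs ht)] with u hu
    exact hgv _ hu θ
  have hga := hE g e₀ hgL
  set ι : C(K, ℂ) := ⟨fun θ => circleMap z₀ r θ,
    (continuous_circleMap z₀ r).comp continuous_subtype_val⟩ with hι
  set κ : C(K, ℂ) := ⟨fun θ => (2 * Real.pi * I)⁻¹ * deriv (circleMap z₀ r) θ, by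
    simp only [deriv_circleMap]
    have := continuous_circleMap 0 r
    fun_prop⟩ with hκ
  have hunit : ∀ z ∈ Metric.ball z₀ r, IsUnit (ι - algebraMap ℂ C(K, ℂ) z) := by
    intro z hz
    rw [ContinuousMap.isUnit_iff_forall_ne_zero]
    intro θ h0
    have : circleMap z₀ r θ = z := by simpa [hι, sub_eq_zero] using h0
    have h1 : circleMap z₀ r θ ∈ Metric.sphere z₀ r := circleMap_mem_sphere z₀ hr0.le θ
    rw [this, Metric.mem_sphere] at h1
    rw [Metric.mem_ball, h1] at hz
    exact lt_irrefl _ hz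
  have hka : AnalyticAt ℂ (fun z : ℂ => κ * Ring.inverse (ι - algebraMap ℂ C(K, ℂ) z)) z₀ := by
    refine analyticAt_const.mul ?_
    obtain ⟨u, hu⟩ := hunit z₀ (Metric.mem_ball_self hr0)
    have h1 : AnalyticAt ℂ (Ring.inverse : C(K, ℂ) → C(K, ℂ)) (ι - algebraMap ℂ C(K, ℂ) z₀) := by
      rw [← hu]
      exact analyticAt_inverse u
    refine AnalyticAt.comp (f := fun z : ℂ => ι - algebraMap ℂ C(K, ℂ) z) h1 ?_
    exact analyticAt_const.sub ((Algebra.linearMap ℂ C(K, ℂ)).toContinuousLinearMap.analyticAt _)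
  have hfin : AnalyticAt ℂ (fun p : ℂ × E =>
      intervalPairing F (2 * Real.pi) (κ * Ring.inverse (ι - algebraMap ℂ C(K, ℂ) p.1)) (g p.2))
      (z₀, e₀) :=
    ((intervalPairing F (2 * Real.pi)).analyticAt_bilinear _).comp₂
      (AnalyticAt.comp (g := fun z => κ * Ring.inverse (ι - algebraMap ℂ C(K, ℂ) z))
        (f := Prod.fst) hka analyticAt_fst)
      (AnalyticAt.comp (g := g) (f := Prod.snd) hga analyticAt_snd)
  refine hfin.congr ?_
  have hnh : Metric.ball z₀ r ×ˢ Metric.ball e₀ R ∈ nhds (z₀, e₀) :=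
    prod_mem_nhds (Metric.ball_mem_nhds _ hr0) (Metric.ball_mem_nhds _ hR)
  filter_upwards [hnh] with ⟨z, e⟩ ⟨hz, he⟩
  simp only at hz he ⊢
  rw [intervalPairing_apply]
  have hinv : ∀ θ : K, (Ring.inverse (ι - algebraMap ℂ C(K, ℂ) z)) θ = (circleMap z₀ r θ - z)⁻¹ := by
    intro θ
    have h1 := Ring.inverse_mul_cancel _ (hunit z hz)
    have h2 := congrArg (fun G : C(K, ℂ) => G θ) h1
    refine eq_inv_of_mul_eq_one_left ?_
    simpa [hι] using h2
  have hdc : DiffContOnCl ℂ (fun z => f (z, e)) (Metric.ball z₀ r) := by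
    apply DifferentiableOn.diffContOnCl
    intro t ht
    have h0 := (hball _ (hmem t (Metric.closure_ball_subset_closedBall ht) e he)).2 (1, 0)
    have h2 : DifferentiableAt ℂ (fun u : ℂ => u - t) t := by fun_prop
    have h3 := DifferentiableAt.comp t (by simpa using h0) h2
    apply DifferentiableAt.differentiableWithinAt
    refine h3.congr_of_eventuallyEq (Filter.Eventually.of_forall fun u => ?_)
    simp
  have hC := hdc.circleIntegral_sub_inv_smul hz
  have hsub := integral_subtype_comap (μ := (volume : Measure ℝ)) (s := K) measurableSet_Icc
    (fun θ => ((2 * Real.pi * I)⁻¹ * deriv (circleMap z₀ r) θ * (circleMap z₀ r θ - z)⁻¹) •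
      f (circleMap z₀ r θ, e))
  simp only [ContinuousMap.mul_apply, hinv, hgv e he]
  simp only [hκ, ContinuousMap.coe_mk]
  rw [hsub, integral_Icc_eq_integral_Ioc,
    ← intervalIntegral.integral_of_le (by positivity)]
  rw [circleIntegral] at hC
  simp_rw [mul_assoc, mul_smul]
  rw [intervalIntegral.integral_smul]
  simp_rw [mul_smul] at hC
  rw [hC, smul_smul, smul_smul, smul_smul, ← mul_assoc]
  have : (2 * (Real.pi : ℂ) * I)⁻¹ * 2 * Real.pi * I = 1 := by
    field_simp [Real.pi_ne_zero]
  rw [this, one_smul]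

theorem LineHolomorphicNear.comp_equiv {E E' F : Type*} [NormedAddCommGroup E] [NormedSpace ℂ E]
    [NormedAddCommGroup E'] [NormedSpace ℂ E']
    [NormedAddCommGroup F] [NormedSpace ℂ F] (L : E' ≃L[ℂ] E) {f : E → F} {p₀ : E}
    (hf : LineHolomorphicNear f p₀) : LineHolomorphicNear (f ∘ L) (L.symm p₀) := by
  have : Filter.Tendsto L (nhds (L.symm p₀)) (nhds p₀) := by
    simpa using L.continuous.tendsto (L.symm p₀)
  filter_upwards [this.eventually hf] with p hp
  refine ⟨hp.1.comp L.continuous.continuousAt, fun v => ?_⟩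
  simpa using hp.2 (L v)

theorem LineHolomorphicNear.analyticAt_of_equiv {E E' F : Type*} [NormedAddCommGroup E]
    [NormedSpace ℂ E] [NormedAddCommGroup E'] [NormedSpace ℂ E']
    [NormedAddCommGroup F] [NormedSpace ℂ F] (L : E' ≃L[ℂ] E)
    (h : ∀ (g : E' → F) (e₀ : E'), LineHolomorphicNear g e₀ → AnalyticAt ℂ g e₀)
    {f : E → F} {p₀ : E} (hf : LineHolomorphicNear f p₀) : AnalyticAt ℂ f p₀ := by
  have h1 := h _ _ (hf.comp_equiv L)
  have h2 := AnalyticAt.comp (f := L.symm) (g := f ∘ L) (x := p₀) h1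
    (L.symm.toContinuousLinearMap.analyticAt p₀)
  have h3 : (f ∘ L) ∘ L.symm = f := by ext; simp
  rwa [h3] at h2

theorem LineHolomorphicNear.analyticAt_fin (d : ℕ) : ∀ (F : Type) [NormedAddCommGroup F]
    [NormedSpace ℂ F] [CompleteSpace F] (f : (Fin d → ℂ) → F) (p₀ : Fin d → ℂ),
    LineHolomorphicNear f p₀ → AnalyticAt ℂ f p₀ := by
  induction d with
  | zero =>
    intro F _ _ _ f p₀ _
    have : f = fun _ => f p₀ := by
      ext p
      rw [Subsingleton.elim p p₀]
    rw [this]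
    exact analyticAt_const
  | succ d ih =>
    intro F _ _ _ f p₀ hf
    exact hf.analyticAt_of_equiv (Fin.consEquivL ℂ (fun _ : Fin (d + 1) => ℂ))
      (fun g e₀ hg => hg.analyticAt_prod (ih C(Set.Icc 0 (2 * Real.pi), F)))

/-- **Osgood's lemma**: a continuous function of finitely many complex variables which is
holomorphic along every complex line is analytic. -/
theorem LineHolomorphicNear.analyticAt {E F : Type} [NormedAddCommGroup E] [NormedSpace ℂ E]
    [FiniteDimensional ℂ E] [NormedAddCommGroup F] [NormedSpace ℂ F] [CompleteSpace F]
    {f : E → F} {p₀ : E} (hf : LineHolomorphicNear f p₀) : AnalyticAt ℂ f p₀ :=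
  hf.analyticAt_of_equiv (ContinuousLinearEquiv.ofFinrankEq (by simp))
    (LineHolomorphicNear.analyticAt_fin (Module.finrank ℂ E) F)

/-- Analyticity of dominated parameter integrals. -/
theorem analyticAt_integral_of_dominated {E X : Type} [NormedAddCommGroup E] [NormedSpace ℂ E]
    [FiniteDimensional ℂ E] [MeasurableSpace X] {μ : Measure X} {f : E → X → ℂ} {p₀ : E}
    {U : Set E} {bound : X → ℝ} (hU : U ∈ nhds p₀) (hb : Integrable bound μ)
    (hm : ∀ p ∈ U, AEStronglyMeasurable (f p) μ)
    (h : ∀ᵐ x ∂μ, ∀ p ∈ U, AnalyticAt ℂ (fun p => f p x) p ∧ ‖f p x‖ ≤ bound x) :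
    AnalyticAt ℂ (fun p => ∫ x, f p x ∂μ) p₀ := by
  refine LineHolomorphicNear.analyticAt ?_
  filter_upwards [eventually_mem_nhds_iff.2 hU] with p hp
  refine ⟨?_, fun v => ?_⟩
  · refine continuousAt_of_dominated (bound := bound) (Filter.mem_of_superset hp hm) ?_ hb ?_
    · filter_upwards [hp] with q hq
      filter_upwards [h] with x hx using (hx q hq).2
    · filter_upwards [h] with x hx using (hx p (mem_of_mem_nhds hp)).1.continuousAt
  have hline : Continuous fun t : ℂ => p + t • v := by fun_prop
  have : (fun t : ℂ => p + t • v) ⁻¹' U ∈ nhds (0 : ℂ) := by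
    apply hline.continuousAt.preimage_mem_nhds
    simpa using hp
  obtain ⟨δ, hδ, hδs⟩ := Metric.nhds_basis_closedBall.mem_iff.1 this
  have hdiff : ∀ᵐ x ∂μ, ∀ t ∈ Metric.closedBall (0 : ℂ) δ,
      DifferentiableAt ℂ (fun t : ℂ => f (p + t • v) x) t := by
    filter_upwards [h] with x hx t ht
    refine DifferentiableAt.comp (g := fun p => f p x) t (hx _ (hδs ht)).1.differentiableAt ?_
    fun_prop
  have hsub : ∀ t ∈ Metric.ball (0 : ℂ) (δ / 2), Metric.closedBall t (δ / 2) ⊆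
      Metric.closedBall (0 : ℂ) δ := by
    intro t ht
    apply Metric.closedBall_subset_closedBall'
    rw [Metric.mem_ball] at ht
    linarith
  have hmF' : AEStronglyMeasurable (fun x => deriv (fun t : ℂ => f (p + t • v) x) 0) μ := by
    have hu : ∀ n : ℕ, ((δ / (n + 1) : ℝ) : ℂ) ∈ Metric.closedBall (0 : ℂ) δ := by
      intro n
      rw [mem_closedBall_zero_iff, norm_real, Real.norm_of_nonneg (by positivity)]
      exact div_le_self hδ.le (by linarith [(Nat.cast_nonneg n : (0 : ℝ) ≤ n)])
    have hlim : Filter.Tendsto (fun n : ℕ => ((δ / (n + 1) : ℝ) : ℂ)) Filter.atTop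
        (nhdsWithin 0 {0}ᶜ) := by
      refine tendsto_nhdsWithin_iff.2 ⟨?_, Filter.Eventually.of_forall fun n => ?_⟩
      · have : Filter.Tendsto (fun n : ℕ => δ / ((n : ℝ) + 1)) Filter.atTop (nhds 0) := by
          have := (tendsto_one_div_add_atTop_nhds_zero_nat (𝕜 := ℝ)).const_mul δ
          simpa [div_eq_mul_inv] using this
        exact (continuous_ofReal.tendsto' 0 0 (by simp)).comp this
      · simp only [Set.mem_compl_iff, Set.mem_singleton_iff, ofReal_eq_zero]
        positivity
    refine aestronglyMeasurable_of_tendsto_ae Filter.atTop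
      (f := fun (n : ℕ) x => ((δ / (n + 1) : ℝ) : ℂ)⁻¹ •
        (f (p + ((δ / (n + 1) : ℝ) : ℂ) • v) x - f p x)) (fun n => ?_) ?_
    · exact AEStronglyMeasurable.const_smul (f := fun x =>
        f (p + ((δ / (n + 1) : ℝ) : ℂ) • v) x - f p x)
        ((hm _ (hδs (hu n))).sub (hm p (mem_of_mem_nhds hp))) ((δ / (n + 1) : ℝ) : ℂ)⁻¹
    · filter_upwards [hdiff] with x hx
      have h1 := hasDerivAt_iff_tendsto_slope_zero.1
        (hx 0 (Metric.mem_closedBall_self hδ.le)).hasDerivAt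
      have h2 := h1.comp hlim
      simpa only [Function.comp_def, zero_add, zero_smul, add_zero] using h2
  refine (hasDerivAt_integral_of_dominated_loc_of_deriv_le (F := fun t x => f (p + t • v) x)
    (F' := fun t x => deriv (fun t : ℂ => f (p + t • v) x) t)
    (bound := fun x => bound x / (δ / 2))
    (Metric.ball_mem_nhds (0 : ℂ) (half_pos hδ)) ?_ ?_ hmF' ?_ (hb.div_const _)
    ?_).2.differentiableAt
  · filter_upwards [this] with t ht using hm _ ht
  · refine hb.mono' (hm _ (by simpa using mem_of_mem_nhds hp)) ?_
    filter_upwards [h] with x hx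
    exact (hx _ (by simpa using mem_of_mem_nhds hp)).2
  · filter_upwards [h, hdiff] with x hx hx' t ht
    refine norm_deriv_le_of_forall_mem_sphere_norm_le (half_pos hδ) ?_ ?_
    · apply DifferentiableOn.diffContOnCl
      intro u hu
      exact (hx' u (hsub t ht (Metric.closure_ball_subset_closedBall hu))).differentiableWithinAt
    · intro u hu
      exact (hx _ (hδs (hsub t ht (Metric.sphere_subset_closedBall hu)))).2
  · filter_upwards [hdiff] with x hx t ht
    exact (hx t (hsub t ht (Metric.mem_closedBall_self (half_pos hδ).le))).hasDerivAt

/-- `H` becomes analytic near `p₀` after multiplication by `(s - s₀) ^ M`. When `0 < M`, nothing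
is asserted on the hyperplane `s = s₀` itself. -/
def HasPoleOrderAt {W : Type} [NormedAddCommGroup W] [NormedSpace ℂ W] (M : ℕ)
    (H : ℂ × W → ℂ) (p₀ : ℂ × W) : Prop :=
  ∃ h : ℂ × W → ℂ, AnalyticAt ℂ h p₀ ∧
    ∀ᶠ p in nhds p₀, (p.1 ≠ p₀.1 ∨ M = 0) → (p.1 - p₀.1) ^ M * H p = h p

namespace HasPoleOrderAt

variable {W : Type} [NormedAddCommGroup W] [NormedSpace ℂ W] {M M' : ℕ}
  {H H' : ℂ × W → ℂ} {p₀ : ℂ × W}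

theorem of_analyticAt (h : AnalyticAt ℂ H p₀) : HasPoleOrderAt 0 H p₀ :=
  ⟨H, h, by simp⟩

theorem analyticAt (h : HasPoleOrderAt 0 H p₀) : AnalyticAt ℂ H p₀ := by
  obtain ⟨g, hg, he⟩ := h
  refine hg.congr ?_
  filter_upwards [he] with p hp
  simpa using (hp (Or.inr rfl)).symm

theorem analyticAt_fst_sub : AnalyticAt ℂ (fun p : ℂ × W => p.1 - p₀.1) p₀ :=
  analyticAt_fst.sub analyticAt_const

theorem mono (h : HasPoleOrderAt M H p₀) (hM : M ≤ M') : HasPoleOrderAt M' H p₀ := by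
  obtain ⟨g, hg, he⟩ := h
  refine ⟨fun p => (p.1 - p₀.1) ^ (M' - M) * g p, (analyticAt_fst_sub.pow _).mul hg, ?_⟩
  filter_upwards [he] with p hp hc
  rw [← hp (hc.imp_right fun h => by omega), ← mul_assoc, ← pow_add, Nat.sub_add_cancel hM]

theorem congr (h : HasPoleOrderAt M H p₀) (he : ∀ᶠ p in nhds p₀, H' p = H p) :
    HasPoleOrderAt M H' p₀ := by
  obtain ⟨g, hg, hg'⟩ := h
  refine ⟨g, hg, ?_⟩
  filter_upwards [he, hg'] with p h1 h2
  rwa [h1]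

theorem add (h : HasPoleOrderAt M H p₀) (h' : HasPoleOrderAt M H' p₀) :
    HasPoleOrderAt M (fun p => H p + H' p) p₀ := by
  obtain ⟨g, hg, he⟩ := h
  obtain ⟨g', hg', he'⟩ := h'
  refine ⟨fun p => g p + g' p, hg.add hg', ?_⟩
  filter_upwards [he, he'] with p h1 h2 hc
  rw [← h1 hc, ← h2 hc, mul_add]

theorem sum {ι : Type*} (t : Finset ι) {H : ι → ℂ × W → ℂ}
    (h : ∀ i ∈ t, HasPoleOrderAt M (H i) p₀) :
    HasPoleOrderAt M (fun p => ∑ i ∈ t, H i p) p₀ := by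
  induction t using Finset.induction_on with
  | empty => simpa using (of_analyticAt analyticAt_const).mono M.zero_le
  | insert i t hi ih =>
    simp only [Finset.sum_insert hi]
    exact (h i (by simp)).add (ih fun j hj => h j (by simp [hj]))

theorem mul (h : HasPoleOrderAt M H p₀) (h' : HasPoleOrderAt M' H' p₀) :
    HasPoleOrderAt (M + M') (fun p => H p * H' p) p₀ := by
  obtain ⟨g, hg, he⟩ := h
  obtain ⟨g', hg', he'⟩ := h'
  refine ⟨fun p => g p * g' p, hg.mul hg', ?_⟩
  filter_upwards [he, he'] with p h1 h2 hc
  rw [← h1 (hc.imp_right fun h => by omega), ← h2 (hc.imp_right fun h => by omega), pow_add]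
  ring

theorem prod {ι : Type*} (t : Finset ι) {H : ι → ℂ × W → ℂ} {M : ι → ℕ}
    (h : ∀ i ∈ t, HasPoleOrderAt (M i) (H i) p₀) :
    HasPoleOrderAt (∑ i ∈ t, M i) (fun p => ∏ i ∈ t, H i p) p₀ := by
  induction t using Finset.induction_on with
  | empty => simpa using of_analyticAt analyticAt_const
  | insert i t hi ih =>
    simp only [Finset.sum_insert hi, Finset.prod_insert hi]
    exact (h i (by simp)).mul (ih fun j hj => h j (by simp [hj]))

end HasPoleOrderAt

/-- The pairs `(s, w)` with all `w_k` in the open right half-plane. -/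
def rightDomain (n : ℕ) : Set (ℂ × (Fin n → ℂ)) := {p | ∀ k, 0 < (p.2 k).re}

theorem isOpen_rightDomain (n : ℕ) : IsOpen (rightDomain n) := by
  simp only [rightDomain, Set.ofPred_forall]
  refine isOpen_iInter_of_finite fun k => ?_
  exact isOpen_lt continuous_const (Complex.continuous_re.comp (by fun_prop))

/-- The real unit cube, inside complex space. -/
def unitBox (n : ℕ) : Set (Fin n → ℂ) := Set.univ.pi fun _ => ((↑) : ℝ → ℂ) '' Set.Icc 0 1

theorem isCompact_unitBox (n : ℕ) : IsCompact (unitBox n) :=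
  isCompact_univ_pi fun _ => isCompact_Icc.image Complex.continuous_ofReal

/-- The product of Lebesgue measures on `(0, ∞)`. -/
def orthant (n : ℕ) : Measure (Fin n → ℝ) := Measure.pi fun _ => volume.restrict (Set.Ioi 0)

theorem orthant_eq (n : ℕ) :
    orthant n = volume.restrict (Set.univ.pi fun _ => Set.Ioi 0) := by
  rw [orthant, volume_pi, Measure.restrict_pi_pi]

instance (n : ℕ) : SigmaFinite (orthant n) := by unfold orthant; infer_instance

/-- The coordinatewise change of variables `x = e^{-τ}`. -/
def expNeg {n : ℕ} (τ : Fin n → ℝ) : Fin n → ℂ := fun k => cexp (-τ k)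

theorem ofReal_exp_neg (t : ℝ) : ((Real.exp (-t) : ℝ) : ℂ) = cexp (-t) := by simp

theorem measurableSet_pos (n : ℕ) :
    MeasurableSet (Set.univ.pi fun _ : Fin n => Set.Ioi (0 : ℝ)) :=
  MeasurableSet.univ_pi fun _ => measurableSet_Ioi

theorem ae_orthant_pos (n : ℕ) : ∀ᵐ τ ∂(orthant n), ∀ k, 0 < τ k := by
  rw [orthant_eq]
  filter_upwards [ae_restrict_mem (measurableSet_pos n)] with τ h k
  exact h k trivial

theorem expNeg_mem {n : ℕ} {τ : Fin n → ℝ} (h : ∀ k, 0 ≤ τ k) : expNeg τ ∈ unitBox n :=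
  fun k _ => ⟨Real.exp (-τ k), ⟨(Real.exp_pos _).le, by simpa using h k⟩, ofReal_exp_neg _⟩

theorem continuous_expNeg {n : ℕ} : Continuous (expNeg (n := n)) := by
  unfold expNeg
  fun_prop

theorem integrable_exp_orthant {n : ℕ} {δ : ℝ} (hδ : 0 < δ) :
    Integrable (fun τ : Fin n → ℝ => Real.exp (-δ * ∑ k, τ k)) (orthant n) := by
  have h : Integrable (fun τ : Fin n → ℝ => ∏ k, Real.exp (-δ * τ k)) (orthant n) := by
    exact Integrable.fintype_prod (f := fun _ t => Real.exp (-δ * t))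
      fun _ => exp_neg_integrableOn_Ioi 0 hδ
  refine h.congr (Filter.Eventually.of_forall fun τ => ?_)
  simp only [← Real.exp_sum, Finset.mul_sum]

/-- The class of analytic amplitudes: analytic around the right domain times the unit cube. -/
def Amplitude {n : ℕ} (G : (ℂ × (Fin n → ℂ)) × (Fin n → ℂ) → ℂ) : Prop :=
  AnalyticOnNhd ℂ G (rightDomain n ×ˢ unitBox n)

/-- The integrand `e^{-β·τ} G(p, e^{-τ})`. -/
def kernel {n : ℕ} (β : Fin n → ℂ) (F : (Fin n → ℂ) → ℂ) (τ : Fin n → ℝ) : ℂ :=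
  cexp (-∑ k, β k * τ k) * F (expNeg τ)

theorem aestronglyMeasurable_kernel {n : ℕ} {β : Fin n → ℂ} {F : (Fin n → ℂ) → ℂ}
    (hF : ContinuousOn F (unitBox n)) : AEStronglyMeasurable (kernel β F) (orthant n) := by
  rw [orthant_eq]
  refine ContinuousOn.aestronglyMeasurable ?_ (measurableSet_pos n)
  unfold kernel
  refine ContinuousOn.mul (by fun_prop) ?_
  refine hF.comp continuous_expNeg.continuousOn fun τ hτ => expNeg_mem fun k => ?_
  exact (hτ k trivial).le

theorem norm_kernel_le {n : ℕ} {β : Fin n → ℂ} {F : (Fin n → ℂ) → ℂ} {C δ : ℝ}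
    (hδ : ∀ k, δ ≤ (β k).re) (hC : ∀ x ∈ unitBox n, ‖F x‖ ≤ C) {τ : Fin n → ℝ}
    (hτ : ∀ k, 0 < τ k) : ‖kernel β F τ‖ ≤ C * Real.exp (-δ * ∑ k, τ k) := by
  have hx := hC _ (expNeg_mem fun k => (hτ k).le)
  rw [kernel, norm_mul, Complex.norm_exp, mul_comm]
  refine mul_le_mul hx ?_ (Real.exp_pos _).le ((norm_nonneg _).trans hx)
  rw [Real.exp_le_exp, Complex.neg_re, Complex.re_sum, neg_mul, neg_le_neg_iff, Finset.mul_sum]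
  refine Finset.sum_le_sum fun k _ => ?_
  rw [Complex.re_mul_ofReal]
  exact mul_le_mul_of_nonneg_right (hδ k) (hτ k).le

theorem exists_lt_forall_lt_re {n : ℕ} {β : Fin n → ℂ} (hβ : ∀ k, 0 < (β k).re) :
    ∃ δ > 0, ∀ k, δ < (β k).re := by
  have h : ∀ᶠ δ in nhdsWithin (0 : ℝ) (Set.Ioi 0), ∀ k, δ < (β k).re :=
    Filter.eventually_all.2 fun k => nhdsWithin_le_nhds (eventually_lt_nhds (hβ k))
  obtain ⟨δ, h1, h2⟩ := (h.and self_mem_nhdsWithin).exists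
  exact ⟨δ, h2, h1⟩

theorem integrable_kernel {n : ℕ} {β : Fin n → ℂ} {F : (Fin n → ℂ) → ℂ}
    (hβ : ∀ k, 0 < (β k).re) (hF : ContinuousOn F (unitBox n)) :
    Integrable (kernel β F) (orthant n) := by
  obtain ⟨δ, hδ, hδβ⟩ := exists_lt_forall_lt_re hβ
  obtain ⟨C, hC⟩ := (isCompact_unitBox n).exists_bound_of_continuousOn hF
  refine Integrable.mono' ((integrable_exp_orthant hδ).const_mul C)
    (aestronglyMeasurable_kernel hF) ?_
  filter_upwards [ae_orthant_pos n] with τ hτ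
  exact norm_kernel_le (fun k => (hδβ k).le) hC hτ

theorem Amplitude.continuousOn {n : ℕ} {G : (ℂ × (Fin n → ℂ)) × (Fin n → ℂ) → ℂ}
    (hG : Amplitude G) {p : ℂ × (Fin n → ℂ)} (hp : p ∈ rightDomain n) :
    ContinuousOn (fun x => G (p, x)) (unitBox n) := fun x hx =>
  ((hG (p, x) ⟨hp, hx⟩).continuousAt.comp
    (f := fun x => (p, x)) (by fun_prop)).continuousWithinAt

theorem Amplitude.analyticAt_integral {n : ℕ} {G : (ℂ × (Fin n → ℂ)) × (Fin n → ℂ) → ℂ}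
    (hG : Amplitude G) {β : ℂ → Fin n → ℂ} (hβ : ∀ k, Differentiable ℂ fun s => β s k)
    {p₀ : ℂ × (Fin n → ℂ)} (hp₀ : p₀ ∈ rightDomain n) (hβ₀ : ∀ k, 0 < (β p₀.1 k).re) :
    AnalyticAt ℂ (fun p => ∫ τ, kernel (β p.1) (fun x => G (p, x)) τ ∂(orthant n)) p₀ := by
  obtain ⟨δ, hδ, hδβ⟩ := exists_lt_forall_lt_re hβ₀
  obtain ⟨C, hC⟩ := (isCompact_unitBox n).exists_bound_of_continuousOn (hG.continuousOn hp₀)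
  have h1 : ∀ᶠ p in nhds p₀, ∀ x ∈ unitBox n, ‖G (p, x)‖ ≤ C + 1 := by
    refine (isCompact_unitBox n).eventually_forall_of_forall_eventually fun x hx => ?_
    have hc : ContinuousAt (fun z : (ℂ × (Fin n → ℂ)) × (Fin n → ℂ) => ‖G (z.1, z.2)‖) (p₀, x) :=
      (hG (p₀, x) ⟨hp₀, hx⟩).continuousAt.norm
    filter_upwards [hc.eventually (eventually_lt_nhds (lt_of_le_of_lt (hC x hx) (lt_add_one C)))]
      with z hz using hz.le
  have h2 : ∀ᶠ p in nhds p₀, ∀ k, δ < (β p.1 k).re := by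
    refine Filter.eventually_all.2 fun k => ?_
    have hc : ContinuousAt (fun p : ℂ × (Fin n → ℂ) => (β p.1 k).re) p₀ :=
      (Complex.continuous_re.comp ((hβ k).continuous.comp continuous_fst)).continuousAt
    exact hc.eventually (eventually_gt_nhds (hδβ k))
  have h3 := (isOpen_rightDomain n).mem_nhds hp₀
  refine analyticAt_integral_of_dominated (Filter.inter_mem (Filter.inter_mem h1 h2) h3)
    ((integrable_exp_orthant hδ).const_mul (C + 1)) ?_ ?_
  · rintro p ⟨-, hp⟩
    exact aestronglyMeasurable_kernel (hG.continuousOn hp)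
  · filter_upwards [ae_orthant_pos n] with τ hτ p hp
    refine ⟨?_, norm_kernel_le (fun k => (hp.1.2 k).le) hp.1.1 hτ⟩
    unfold kernel
    refine AnalyticAt.mul ?_ ?_
    · refine AnalyticAt.cexp (AnalyticAt.neg ?_)
      refine Finset.analyticAt_fun_sum _ fun k _ => AnalyticAt.mul ?_ analyticAt_const
      exact AnalyticAt.comp (g := fun s => β s k) (f := Prod.fst) ((hβ k).analyticAt _)
        analyticAt_fst
    · exact AnalyticAt.comp (g := G) (f := fun p => (p, expNeg τ))
        (hG _ ⟨hp.2, expNeg_mem fun k => (hτ k).le⟩) (analyticAt_id.prod analyticAt_const)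

theorem integral_orthant_eq_zero {n : ℕ} {f : (Fin n → ℝ) → ℂ} (hf : Integrable f (orthant n))
    (k : Fin n) (h : ∀ τ : Fin n → ℝ, (∀ i, 0 < τ i) →
      IntegrableOn (fun t => f (Function.update τ k t)) (Set.Ioi 0) →
        ∫ t in Set.Ioi 0, f (Function.update τ k t) = 0) :
    ∫ τ, f τ ∂(orthant n) = 0 := by
  cases n with
  | zero => exact k.elim0
  | succ m =>
    have hmp := measurePreserving_piFinSuccAbove
      (fun _ : Fin (m + 1) => (volume : Measure ℝ).restrict (Set.Ioi 0)) k
    set e := MeasurableEquiv.piFinSuccAbove (fun _ : Fin (m + 1) => ℝ) k with he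
    have h1 : Integrable (fun q => f (e.symm q))
        (((volume : Measure ℝ).restrict (Set.Ioi 0)).prod (orthant m)) :=
      (hmp.symm e).integrable_comp_emb e.symm.measurableEmbedding |>.2 hf
    have h2 : ∫ τ, f τ ∂(orthant (m + 1)) =
        ∫ q, f (e.symm q) ∂(((volume : Measure ℝ).restrict (Set.Ioi 0)).prod (orthant m)) :=
      ((hmp.symm e).integral_comp e.symm.measurableEmbedding f).symm
    rw [h2, integral_prod_symm _ h1]
    refine integral_eq_zero_of_ae ?_
    filter_upwards [h1.prod_left_ae, ae_orthant_pos m] with τ hτ hpos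
    have hu : ∀ t, e.symm (t, τ) =
        Function.update (Fin.insertNth (α := fun _ => ℝ) k 1 τ) k t := by
      intro t
      rw [Fin.update_insertNth]
      rfl
    simp only [hu] at hτ ⊢
    refine h _ (fun i => ?_) hτ
    refine Fin.succAboveCases k ?_ (fun j => ?_) i
    · simp
    · simpa using hpos j

theorem sum_mul_update {n : ℕ} (β : Fin n → ℂ) (τ : Fin n → ℝ) (k : Fin n) (t : ℝ) :
    ∑ i, β i * (Function.update τ k t i : ℝ) = ∑ i, β i * τ i + β k * (t - τ k) := by
  rw [← sub_eq_iff_eq_add', ← Finset.sum_sub_distrib, Finset.sum_eq_single k]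
  · simp; ring
  · intro i _ hi
    simp [hi]
  · simp

theorem expNeg_update {n : ℕ} (τ : Fin n → ℝ) (k : Fin n) (t : ℝ) :
    expNeg (Function.update τ k t) = Function.update (expNeg τ) k (cexp (-t)) := by
  ext i
  by_cases h : i = k
  · subst h; simp [expNeg]
  · simp [expNeg, h]

theorem update_mem_unitBox {n : ℕ} {x : Fin n → ℂ} (hx : x ∈ unitBox n) (k : Fin n) :
    Function.update x k 1 ∈ unitBox n := by
  intro i _
  by_cases h : i = k
  · subst h; exact ⟨1, by simp, by simp⟩
  · simpa [h] using hx i trivial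

theorem integral_kernel_step {n : ℕ} {β : Fin n → ℂ} {F F' : (Fin n → ℂ) → ℂ} (k : Fin n)
    (hβ : ∀ i, 0 < (β i).re) (hF : ContinuousOn F (unitBox n)) (hF' : ContinuousOn F' (unitBox n))
    (hd : ∀ x ∈ unitBox n, HasDerivAt (fun z => F (Function.update x k z)) (F' x) (x k)) :
    ∫ τ, kernel β F τ ∂(orthant n) = (β k)⁻¹ *
      ∫ τ, kernel (β + Pi.single k 1)
        (fun x => (β k + 1) * F (Function.update x k 1) - F' x) τ ∂(orthant n) := by
  set T : (Fin n → ℂ) → ℂ := fun x => (β k + 1) * F (Function.update x k 1) - F' x with hT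
  have hTc : ContinuousOn T (unitBox n) := by
    refine (continuousOn_const.mul (hF.comp ?_ fun x hx => update_mem_unitBox hx k)).sub hF'
    exact (continuous_id.update k continuous_const).continuousOn
  have hβ' : ∀ i, 0 < ((β + Pi.single k 1 : Fin n → ℂ) i).re := by
    intro i
    by_cases h : i = k
    · subst h
      simpa using add_pos (hβ i) one_pos
    · simpa [h] using hβ i
  have hI := integrable_kernel hβ hF
  have hI' := integrable_kernel hβ' hTc
  have hk : β k ≠ 0 := fun h => by simpa [h] using hβ k
  rw [eq_inv_mul_iff_mul_eq₀ hk, ← integral_const_mul, ← sub_eq_zero,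
    ← integral_sub (hI.const_mul _) hI']
  refine integral_orthant_eq_zero ((hI.const_mul _).sub hI') k fun τ hτ hint => ?_
  obtain ⟨C, hC⟩ := (isCompact_unitBox n).exists_bound_of_continuousOn hF
  set x := expNeg τ with hx
  have hmem : ∀ t : ℝ, 0 ≤ t → Function.update x k (cexp (-t)) ∈ unitBox n := by
    intro t ht
    rw [hx, ← expNeg_update]
    refine expNeg_mem fun i => ?_
    by_cases h : i = k
    · subst h; simpa using ht
    · simpa [h] using (hτ i).le
  have hmem1 : Function.update x k 1 ∈ unitBox n := by simpa using hmem 0 le_rfl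
  set A := cexp (-(∑ i, β i * τ i) + β k * τ k) with hA
  have hexp : ∀ t : ℝ, cexp (-∑ i, β i * (Function.update τ k t i : ℝ)) = A * cexp (-(β k * t)) := by
    intro t
    rw [sum_mul_update, hA, ← Complex.exp_add]
    congr 1
    ring
  set P : ℝ → ℂ := fun t => A * cexp (-(β k * t)) *
    (cexp (-t) * F (Function.update x k 1) - F (Function.update x k (cexp (-t)))) with hP
  have hder : ∀ t ∈ Set.Ici (0 : ℝ), HasDerivAt P
      (β k * kernel β F (Function.update τ k t) -
        kernel (β + Pi.single k 1) T (Function.update τ k t)) t := by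
    intro t ht
    have e0 : HasDerivAt (fun t : ℝ => (t : ℂ)) 1 t := Complex.ofRealCLM.hasDerivAt
    have e1 : HasDerivAt (fun t : ℝ => cexp (-(t : ℂ))) (cexp (-t) * -1) t := e0.neg.cexp
    have e2 : HasDerivAt (fun t : ℝ => cexp (-(β k * t))) (cexp (-(β k * t)) * -(β k * 1)) t :=
      (e0.const_mul _).neg.cexp
    have h3 := hd _ (hmem t ht)
    simp only [Function.update_idem, Function.update_self] at h3
    have e3 : HasDerivAt (fun t : ℝ => F (Function.update x k (cexp (-(t : ℂ)))))
        (F' (Function.update x k (cexp (-t))) * (cexp (-t) * -1)) t :=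
      HasDerivAt.comp (h₂ := fun z => F (Function.update x k z)) (h := fun t : ℝ => cexp (-(t : ℂ)))
        t h3 e1
    have := (e2.const_mul A).mul ((e1.mul_const (F (Function.update x k 1))).sub e3)
    refine this.congr_deriv ?_
    have hs : ∀ t : ℝ, cexp (-∑ i, (β + Pi.single k 1 : Fin n → ℂ) i *
        (Function.update τ k t i : ℝ)) = A * cexp (-(β k * t)) * cexp (-t) := by
      intro t
      rw [← hexp, ← Complex.exp_add]
      congr 1
      simp only [Pi.add_apply, add_mul, Finset.sum_add_distrib, neg_add]
      congr 2
      rw [Finset.sum_eq_single k]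
      · simp
      · intro i _ hi; simp [hi]
      · simp
    simp only [kernel, hexp, hs, expNeg_update, ← hx, hT, Function.update_idem, Pi.sub_apply]
    ring
  have hlim : Filter.Tendsto P Filter.atTop (nhds 0) := by
    refine squeeze_zero_norm' (a := fun t : ℝ => ‖A‖ * Real.exp (-(β k).re * t) * (C + C)) ?_ ?_
    · filter_upwards [Filter.eventually_ge_atTop 0] with t ht
      rw [hP, norm_mul, norm_mul, Complex.norm_exp]
      refine mul_le_mul ?_ ?_ (norm_nonneg _) (by positivity)
      · simp [Complex.norm_exp]
      · refine (norm_sub_le _ _).trans (add_le_add ?_ (hC _ (hmem t ht)))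
        rw [norm_mul, Complex.norm_exp]
        refine (mul_le_of_le_one_left (norm_nonneg _) ?_).trans (hC _ hmem1)
        simpa using ht
    · have h1 : Filter.Tendsto (fun t : ℝ => Real.exp (-(β k).re * t)) Filter.atTop (nhds 0) :=
        Real.tendsto_exp_atBot.comp
          (Filter.tendsto_id.const_mul_atTop_of_neg (neg_lt_zero.2 (hβ k)))
      simpa using (h1.const_mul ‖A‖).mul_const (C + C)
  have hfin := integral_Ioi_of_hasDerivAt_of_tendsto' hder hint hlim
  rw [hfin]
  simp [hP]

theorem Amplitude.exists_step {n : ℕ} {G : (ℂ × (Fin n → ℂ)) × (Fin n → ℂ) → ℂ}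
    (hG : Amplitude G) {β : ℂ → Fin n → ℂ} (hβ : ∀ k, Differentiable ℂ fun s => β s k)
    (k : Fin n) : ∃ G' : (ℂ × (Fin n → ℂ)) × (Fin n → ℂ) → ℂ, Amplitude G' ∧
      ∀ p ∈ rightDomain n, (∀ i, 0 < (β p.1 i).re) →
        ∫ τ, kernel (β p.1) (fun x => G (p, x)) τ ∂(orthant n) = (β p.1 k)⁻¹ *
          ∫ τ, kernel (β p.1 + Pi.single k 1) (fun x => G' (p, x)) τ ∂(orthant n) := by
  have h1 : Amplitude fun z : (ℂ × (Fin n → ℂ)) × (Fin n → ℂ) =>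
      G (z.1, Function.update z.2 k 1) := by
    rintro ⟨p, x⟩ ⟨hp, hx⟩
    refine AnalyticAt.comp (g := G) (f := fun z : (ℂ × (Fin n → ℂ)) × (Fin n → ℂ) =>
      (z.1, Function.update z.2 k 1)) (hG _ ⟨hp, update_mem_unitBox hx k⟩)
      (analyticAt_fst.prod (AnalyticAt.pi fun i => ?_))
    by_cases h : i = k
    · subst h
      simpa using analyticAt_const
    · simp only [Function.update_of_ne h]
      exact ((ContinuousLinearMap.proj (R := ℂ) (φ := fun _ : Fin n => ℂ) i).comp
        (ContinuousLinearMap.snd ℂ (ℂ × (Fin n → ℂ)) (Fin n → ℂ))).analyticAt _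
  have h2 : Amplitude fun z : (ℂ × (Fin n → ℂ)) × (Fin n → ℂ) =>
      fderiv ℂ G z (0, Pi.single k 1) := by
    intro z hz
    exact ((ContinuousLinearMap.apply ℂ ℂ
      ((0, Pi.single k 1) : (ℂ × (Fin n → ℂ)) × (Fin n → ℂ))).analyticAt _).comp
      (AnalyticOnNhd.fderiv hG z hz)
  refine ⟨fun z => (β z.1.1 k + 1) * G (z.1, Function.update z.2 k 1) -
    fderiv ℂ G z (0, Pi.single k 1), ?_, ?_⟩
  · intro z hz
    refine AnalyticAt.sub (AnalyticAt.mul ?_ (h1 z hz)) (h2 z hz)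
    refine AnalyticAt.add ?_ analyticAt_const
    exact AnalyticAt.comp (g := fun s => β s k)
      (f := fun z : (ℂ × (Fin n → ℂ)) × (Fin n → ℂ) => z.1.1) ((hβ k).analyticAt _)
      (AnalyticAt.comp (g := Prod.fst) (f := Prod.fst) analyticAt_fst analyticAt_fst)
  · intro p hp hpos
    refine integral_kernel_step (F := fun x => G (p, x))
      (F' := fun x => fderiv ℂ G (p, x) (0, Pi.single k 1)) k hpos (hG.continuousOn hp)
      (h2.continuousOn hp) fun x hx => ?_
    have hd := (hG (p, x) ⟨hp, hx⟩).differentiableAt.hasFDerivAt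
    have hu : HasDerivAt (fun z : ℂ => (p, Function.update x k z))
        ((0, Pi.single k 1) : (ℂ × (Fin n → ℂ)) × (Fin n → ℂ)) (x k) :=
      (hasDerivAt_const _ _).prodMk (hasDerivAt_update x k (x k))
    have hx' : (p, x) = (p, Function.update x k (x k)) := by simp
    rw [hx'] at hd
    have := hd.comp_hasDerivAt _ hu
    simp only [Function.update_eq_self] at this
    exact this

theorem Amplitude.exists_step_finset {n : ℕ} {G : (ℂ × (Fin n → ℂ)) × (Fin n → ℂ) → ℂ}
    (hG : Amplitude G) {β : ℂ → Fin n → ℂ} (hβ : ∀ k, Differentiable ℂ fun s => β s k)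
    (t : Finset (Fin n)) : ∃ G' : (ℂ × (Fin n → ℂ)) × (Fin n → ℂ) → ℂ, Amplitude G' ∧
      ∀ p ∈ rightDomain n, (∀ i, 0 < (β p.1 i).re) →
        ∫ τ, kernel (β p.1) (fun x => G (p, x)) τ ∂(orthant n) = (∏ k ∈ t, β p.1 k)⁻¹ *
          ∫ τ, kernel (β p.1 + fun i => if i ∈ t then 1 else 0) (fun x => G' (p, x)) τ
            ∂(orthant n) := by
  induction t using Finset.induction_on with
  | empty =>
    refine ⟨G, hG, fun p _ _ => ?_⟩
    have : (β p.1 + fun _ => (0 : ℂ)) = β p.1 := by ext; simp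
    simp [this]
  | insert k t hk ih =>
    obtain ⟨G₁, hG₁, h₁⟩ := ih
    obtain ⟨G₂, hG₂, h₂⟩ := hG₁.exists_step
      (β := fun s => β s + fun i => if i ∈ t then 1 else 0) (fun i => (hβ i).add_const _) k
    refine ⟨G₂, hG₂, fun p hp hpos => ?_⟩
    have hs : ((β p.1 + fun i => if i ∈ t then (1 : ℂ) else 0) + Pi.single k 1) =
        β p.1 + fun i => if i ∈ insert k t then 1 else 0 := by
      ext i
      by_cases h : i = k
      · subst h; simp [hk]
      · simp [h]
    rw [h₁ p hp hpos, h₂ p hp, hs, Finset.prod_insert hk, mul_inv, ← mul_assoc]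
    · simp [hk, mul_comm]
    · intro i
      by_cases h : i ∈ t
      · simpa [h] using add_pos (hpos i) one_pos
      · simpa [h] using hpos i

/-- Affine exponents `b_k s - c_k`. -/
def affineExp {n : ℕ} (b : Fin n → ℕ) (c : Fin n → ℤ) (s : ℂ) (k : Fin n) : ℂ := b k * s - c k

theorem exists_continuation_of_amplitude {n : ℕ} (b : Fin n → ℕ) (c : Fin n → ℤ)
    (hbc : ∀ k, b k = 0 → c k < 0) {G : (ℂ × (Fin n → ℂ)) × (Fin n → ℂ) → ℂ}
    (hG : Amplitude G) : ∃ H : ℂ × (Fin n → ℂ) → ℂ,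
      (∀ p ∈ rightDomain n, (∀ k, 0 < (affineExp b c p.1 k).re) →
        H p = ∫ τ, kernel (affineExp b c p.1) (fun x => G (p, x)) τ ∂(orthant n)) ∧
      ∀ p ∈ rightDomain n, HasPoleOrderAt
        (Finset.univ.filter fun k => ∃ l : ℕ, affineExp b c p.1 k = -l).card H p := by
  set α := affineExp b c with hα
  have hdiff : ∀ (L : ℕ) k, Differentiable ℂ fun s => α s k + L := by
    intro L k
    simp only [hα, affineExp]
    fun_prop
  have hstep : ∀ (L : ℕ) (G : {G : (ℂ × (Fin n → ℂ)) × (Fin n → ℂ) → ℂ // Amplitude G}),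
      ∃ G' : {G : (ℂ × (Fin n → ℂ)) × (Fin n → ℂ) → ℂ // Amplitude G},
      ∀ p ∈ rightDomain n, (∀ i, 0 < (α p.1 i + L).re) →
        ∫ τ, kernel (fun i => α p.1 i + L) (fun x => G.1 (p, x)) τ ∂(orthant n) =
        (∏ k, (α p.1 k + L))⁻¹ *
          ∫ τ, kernel (fun i => α p.1 i + (L + 1 : ℕ)) (fun x => G'.1 (p, x)) τ ∂(orthant n) := by
    rintro L ⟨G, hG⟩
    obtain ⟨G', hG', h⟩ := hG.exists_step_finset (hdiff L) Finset.univ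
    refine ⟨⟨G', hG'⟩, fun p hp hpos => (h p hp hpos).trans ?_⟩
    congr! 4
    ext i
    simp
    ring
  choose next hnext using hstep
  set Gs : ℕ → {G : (ℂ × (Fin n → ℂ)) × (Fin n → ℂ) → ℂ // Amplitude G} :=
    fun L => Nat.rec ⟨G, hG⟩ (fun L G => next L G) L with hGs
  set J : ℕ → ℂ × (Fin n → ℂ) → ℂ := fun L p =>
    ∫ τ, kernel (fun i => α p.1 i + L) (fun x => (Gs L).1 (p, x)) τ ∂(orthant n) with hJ
  set A : ℕ → ℂ × (Fin n → ℂ) → ℂ := fun L p =>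
    (∏ k, ∏ l ∈ Finset.range L, (α p.1 k + l)⁻¹) * J L p with hA
  have hAs : ∀ p ∈ rightDomain n, ∀ L : ℕ, (∀ i, 0 < (α p.1 i + L).re) → A L p = A (L + 1) p := by
    intro p hp L hpos
    have := hnext L (Gs L) p hp hpos
    simp only [hA, hJ]
    rw [this]
    simp only [Finset.prod_range_succ, Finset.prod_mul_distrib, Finset.prod_inv_distrib, hGs]
    ring
  have hAmono : ∀ p ∈ rightDomain n, ∀ L : ℕ, (∀ i, 0 < (α p.1 i + L).re) →
      ∀ L', L ≤ L' → A L' p = A L p := by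
    intro p hp L hpos L' hL
    induction L', hL using Nat.le_induction with
    | base => rfl
    | succ m hm ih =>
      rw [← hAs p hp m fun i => ?_, ih]
      refine (hpos i).trans_le ?_
      simpa using hm
  have hex : ∀ s : ℂ, ∃ L : ℕ, ∀ i, 0 < (α s i + L).re := by
    intro s
    obtain ⟨L, hL⟩ := exists_nat_gt (∑ i, ‖α s i‖)
    refine ⟨L, fun i => ?_⟩
    have h1 := Finset.single_le_sum (f := fun i => ‖α s i‖) (fun _ _ => norm_nonneg _)
      (Finset.mem_univ i)
    have h2 := (abs_le.1 (Complex.abs_re_le_norm (α s i))).1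
    simp only [add_re, natCast_re]
    linarith
  set H : ℂ × (Fin n → ℂ) → ℂ := fun p => A (Nat.find (hex p.1)) p with hH
  have hHA : ∀ p ∈ rightDomain n, ∀ L : ℕ, (∀ i, 0 < (α p.1 i + L).re) → H p = A L p := by
    intro p hp L hpos
    exact (hAmono p hp _ (Nat.find_spec (hex p.1)) L (Nat.find_min' _ hpos)).symm
  refine ⟨H, fun p hp hpos => ?_, fun p₀ hp₀ => ?_⟩
  · rw [hHA p hp 0 (by simpa using hpos)]
    simp [hA, hJ, hGs]
  · obtain ⟨L, hL⟩ := hex p₀.1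
    have hnear : ∀ᶠ p : ℂ × (Fin n → ℂ) in nhds p₀, H p = A L p := by
      have h1 : ∀ᶠ p : ℂ × (Fin n → ℂ) in nhds p₀, ∀ i, 0 < (α p.1 i + L).re := by
        refine Filter.eventually_all.2 fun i => ?_
        have hc : ContinuousAt (fun p : ℂ × (Fin n → ℂ) => (α p.1 i + L).re) p₀ :=
          (Complex.continuous_re.comp ((hdiff L i).continuous.comp continuous_fst)).continuousAt
        exact hc.eventually (eventually_gt_nhds (hL i))
      filter_upwards [h1, (isOpen_rightDomain n).mem_nhds hp₀] with p h1 h2 using hHA p h2 L h1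
    have hJL : HasPoleOrderAt 0 (J L) p₀ :=
      .of_analyticAt ((Gs L).2.analyticAt_integral (hdiff L) hp₀ hL)
    have hfac : ∀ k (l : ℕ), HasPoleOrderAt (if α p₀.1 k = -l then 1 else 0)
        (fun p : ℂ × (Fin n → ℂ) => (α p.1 k + l)⁻¹) p₀ := by
      intro k l
      split_ifs with h
      · have hb : (b k : ℂ) ≠ 0 := by
          intro hb
          have h1 := hbc k (by exact_mod_cast hb)
          rw [hα, affineExp, hb, zero_mul, zero_sub, neg_inj] at h
          have : c k = l := by exact_mod_cast h
          omega
        refine ⟨fun _ => (b k : ℂ)⁻¹, analyticAt_const, Filter.Eventually.of_forall fun p hp => ?_⟩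
        have hp' : p.1 - p₀.1 ≠ 0 := sub_ne_zero.2 (hp.resolve_right one_ne_zero)
        have : α p.1 k + l = b k * (p.1 - p₀.1) := by
          have : (l : ℂ) = -α p₀.1 k := by rw [h, neg_neg]
          rw [this]
          simp only [hα, affineExp]
          ring
        simp only [this, pow_one]
        field_simp
      · refine .of_analyticAt (AnalyticAt.inv ?_ fun h' => h (eq_neg_of_add_eq_zero_left h'))
        exact AnalyticAt.comp (g := fun s => α s k + l) (f := Prod.fst)
          ((hdiff l k).analyticAt _) analyticAt_fst
    have hprod := (HasPoleOrderAt.prod Finset.univ fun k _ =>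
      HasPoleOrderAt.prod (Finset.range L) fun l _ => hfac k l).mul hJL
    refine (hprod.mono ?_).congr hnear
    rw [add_zero, Finset.card_filter]
    refine Finset.sum_le_sum fun k _ => ?_
    split_ifs with h
    · rw [← Finset.card_filter, Finset.card_le_one]
      intro x hx y hy
      have h1 := (Finset.mem_filter.1 hx).2.symm.trans (Finset.mem_filter.1 hy).2
      exact_mod_cast neg_injective h1
    · refine (Finset.sum_eq_zero fun l _ => if_neg fun hl => h ⟨l, hl⟩).le

/-- The shear `τ_k = σ_k + σ_j` for `k ∈ S \ {j}`, which parametrizes the chamber where `τ_j` is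
the smallest coordinate among those indexed by `S`. -/
def chamberShear {n : ℕ} (S : Finset (Fin n)) (j : Fin n) (σ : Fin n → ℝ) : Fin n → ℝ :=
  fun k => if k ∈ S.erase j then σ k + σ j else σ k

/-- The chamber of the positive orthant where coordinate `j` is the smallest one within `S`. -/
def chamber {n : ℕ} (S : Finset (Fin n)) (j : Fin n) : Set (Fin n → ℝ) :=
  (Set.univ.pi fun _ => Set.Ioi 0) ∩ ⋂ k ∈ S.erase j, {τ | τ j < τ k}

theorem continuous_chamberShear {n : ℕ} (S : Finset (Fin n)) (j : Fin n) :
    Continuous (chamberShear S j) := by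
  refine continuous_pi fun k => ?_
  unfold chamberShear
  split_ifs <;> fun_prop

theorem chamberShear_injective {n : ℕ} (S : Finset (Fin n)) (j : Fin n) :
    Function.Injective (chamberShear S j) := by
  intro σ σ' h
  have hj : σ j = σ' j := by simpa [chamberShear] using congrFun h j
  ext k
  have hk := congrFun h k
  unfold chamberShear at hk
  split_ifs at hk with h1
  · linarith
  · exact hk

theorem measurePreserving_chamberShear {n : ℕ} (S : Finset (Fin n)) (j : Fin n) :
    MeasurePreserving (chamberShear S j) := by
  set v : Fin n → ℝ := fun k => if k ∈ S.erase j then 1 else 0 with hv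
  set T : (Fin n → ℝ) →ₗ[ℝ] (Fin n → ℝ) := LinearMap.transvection (LinearMap.proj j) v with hT
  have hdet : LinearMap.det T = 1 := by
    rw [hT, LinearMap.transvection.det]
    simp [hv]
  have heq : chamberShear S j = T := by
    ext σ k
    simp only [chamberShear, hT, LinearMap.transvection.apply, hv]
    by_cases h : k ∈ S.erase j <;> simp [h, -Finset.mem_erase]
  refine ⟨(continuous_chamberShear S j).measurable, ?_⟩
  rw [heq, Real.map_linearMap_volume_pi_eq_smul_volume_pi (by rw [hdet]; exact one_ne_zero), hdet]
  simp

theorem preimage_chamberShear {n : ℕ} {S : Finset (Fin n)} {j : Fin n} :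
    chamberShear S j ⁻¹' chamber S j = Set.univ.pi fun _ => Set.Ioi 0 := by
  ext σ
  simp only [chamber, Set.mem_preimage, Set.mem_inter_iff, Set.mem_pi, Set.mem_univ, true_imp_iff,
    Set.mem_Ioi, Set.mem_iInter, Set.mem_ofPred_eq]
  have hjj : chamberShear S j σ j = σ j := by simp [chamberShear]
  rw [hjj]
  constructor
  · rintro ⟨h1, h2⟩ k
    by_cases hk : k ∈ S.erase j
    · have := h2 k hk
      simp only [chamberShear, hk, if_true] at this
      linarith
    · simpa [chamberShear, hk] using h1 k
  · intro h
    refine ⟨fun k => ?_, fun k hk => ?_⟩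
    · unfold chamberShear
      split_ifs
      · exact add_pos (h k) (h j)
      · exact h k
    · simp only [chamberShear, hk, if_true]
      linarith [h k]

theorem measurableSet_chamber {n : ℕ} (S : Finset (Fin n)) (j : Fin n) :
    MeasurableSet (chamber S j) := by
  refine (measurableSet_pos n).inter (Finset.measurableSet_biInter _ fun k _ => ?_)
  exact measurableSet_lt (measurable_pi_apply j) (measurable_pi_apply k)

theorem volume_tie {n : ℕ} {j k : Fin n} (h : j ≠ k) :
    (volume : Measure (Fin n → ℝ)) {τ | τ j = τ k} = 0 := by
  have h1 : {τ : Fin n → ℝ | τ j = τ k} = LinearMap.ker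
      ((LinearMap.proj j : (Fin n → ℝ) →ₗ[ℝ] ℝ) - LinearMap.proj k) := by
    ext τ
    simp [sub_eq_zero]
  rw [h1]
  refine Measure.addHaar_submodule _ _ fun h2 => ?_
  rw [LinearMap.ker_eq_top] at h2
  have := LinearMap.congr_fun h2 (Pi.single j 1)
  simp [h.symm] at this

theorem biUnion_chamber_ae_eq {n : ℕ} {S : Finset (Fin n)} (hS : S.Nonempty) :
    (Set.univ.pi fun _ => Set.Ioi 0 : Set (Fin n → ℝ)) =ᵐ[volume] ⋃ j ∈ S, chamber S j := by
  have hties : ∀ᵐ τ : Fin n → ℝ, ∀ j k, j ≠ k → τ j ≠ τ k := by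
    rw [ae_all_iff]; intro j
    rw [ae_all_iff]; intro k
    rw [Filter.eventually_imp_distrib_left]
    intro h
    rw [ae_iff]
    simpa using volume_tie h
  filter_upwards [hties] with τ hτ
  refine propext ⟨fun h => ?_, fun h => ?_⟩
  · obtain ⟨j, hj, hmin⟩ := Finset.exists_min_image S τ hS
    refine Set.mem_biUnion hj ⟨h, ?_⟩
    refine Set.mem_iInter₂.2 fun k hk => ?_
    obtain ⟨hkj, hkS⟩ := Finset.mem_erase.1 hk
    exact lt_of_le_of_ne (hmin k hkS) (hτ j k hkj.symm)
  · obtain ⟨j, -, h⟩ := Set.mem_iUnion₂.1 h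
    exact h.1

theorem integral_orthant_eq_sum_chamber {n : ℕ} {S : Finset (Fin n)} (hS : S.Nonempty)
    {f : (Fin n → ℝ) → ℂ}
    (hf : ∀ j ∈ S, Integrable (fun σ => f (chamberShear S j σ)) (orthant n)) :
    Integrable f (orthant n) ∧
      ∫ τ, f τ ∂(orthant n) = ∑ j ∈ S, ∫ σ, f (chamberShear S j σ) ∂(orthant n) := by
  simp only [orthant_eq] at hf ⊢
  have hemb : ∀ j, MeasurableEmbedding (chamberShear S j) := fun j =>
    (continuous_chamberShear S j).measurableEmbedding (chamberShear_injective S j)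
  have hint : ∀ j ∈ S, IntegrableOn f (chamber S j) := by
    intro j hj
    rw [← (measurePreserving_chamberShear S j).integrableOn_comp_preimage (hemb j),
      preimage_chamberShear]
    exact hf j hj
  have hdisj : Set.PairwiseDisjoint (S : Set (Fin n)) (chamber S) := by
    intro j hj k hk hjk
    refine Set.disjoint_left.2 fun τ h1 h2 => ?_
    have e1 : τ j < τ k := Set.mem_iInter₂.1 h1.2 k (Finset.mem_erase.2 ⟨hjk.symm, hk⟩)
    have e2 : τ k < τ j := Set.mem_iInter₂.1 h2.2 j (Finset.mem_erase.2 ⟨hjk, hj⟩)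
    exact lt_asymm e1 e2
  refine ⟨?_, ?_⟩
  · refine (integrableOn_congr_set_ae (biUnion_chamber_ae_eq hS)).2 ?_
    exact (integrableOn_finset_iUnion).2 hint
  · rw [setIntegral_congr_set (biUnion_chamber_ae_eq hS),
      integral_biUnion_finset _ (fun j _ => measurableSet_chamber S j) hdisj hint]
    refine Finset.sum_congr rfl fun j _ => ?_
    rw [← (measurePreserving_chamberShear S j).setIntegral_preimage_emb (hemb j),
      preimage_chamberShear]

theorem mem_unitBox_re {n : ℕ} {x : Fin n → ℂ} (hx : x ∈ unitBox n) (k : Fin n) :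
    ∃ r : ℝ, 0 ≤ r ∧ r ≤ 1 ∧ x k = r := by
  obtain ⟨r, hr, h⟩ := hx k trivial
  exact ⟨r, hr.1, hr.2, h.symm⟩

/-- The blow-up map `x_k ↦ x_j x_k` for `k ∈ S \ {j}`. -/
def blowUp {n : ℕ} (S : Finset (Fin n)) (j : Fin n) (x : Fin n → ℂ) : Fin n → ℂ :=
  fun k => if k ∈ S.erase j then x k * x j else x k

theorem expNeg_chamberShear {n : ℕ} (S : Finset (Fin n)) (j : Fin n) (σ : Fin n → ℝ) :
    expNeg (chamberShear S j σ) = blowUp S j (expNeg σ) := by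
  ext k
  simp only [expNeg, chamberShear, blowUp]
  split_ifs
  · rw [← Complex.exp_add]
    push_cast
    ring_nf
  · rfl

theorem blowUp_mem {n : ℕ} (S : Finset (Fin n)) (j : Fin n) {x : Fin n → ℂ}
    (hx : x ∈ unitBox n) : blowUp S j x ∈ unitBox n := by
  intro k _
  unfold blowUp
  obtain ⟨r, h0, h1, hr⟩ := mem_unitBox_re hx k
  obtain ⟨r', h0', h1', hr'⟩ := mem_unitBox_re hx j
  dsimp only
  split_ifs
  · exact ⟨r * r', ⟨mul_nonneg h0 h0', mul_le_one₀ h1 h0' h1'⟩, by rw [hr, hr']; push_cast; rfl⟩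
  · exact ⟨r, ⟨h0, h1⟩, hr.symm⟩

/-- The linear form of the `i`-th row. -/
def rowForm {N n : ℕ} (a : Fin N → Fin n → ℂ) (i : Fin N) (x : Fin n → ℂ) : ℂ :=
  ∑ j, a i j * x j

theorem rowForm_blowUp {N n : ℕ} {a : Fin N → Fin n → ℂ} {S : Finset (Fin n)} {i : Fin N}
    (hi : ∀ k, a i k ≠ 0 → k ∈ S) (j : Fin n) (x : Fin n → ℂ) :
    rowForm a i (blowUp S j x) = x j * rowForm a i (Function.update x j 1) := by
  unfold rowForm
  rw [Finset.mul_sum]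
  refine Finset.sum_congr rfl fun k _ => ?_
  by_cases h0 : a i k = 0
  · simp [h0]
  by_cases hk : k = j
  · subst hk
    simp [blowUp, mul_comm]
  · simp only [blowUp, Finset.mem_erase, ne_eq, hk, not_false_eq_true, hi k h0, and_self, if_true,
      Function.update_of_ne]
    ring

theorem rowForm_update {N n : ℕ} {a : Fin N → Fin n → ℂ} {i : Fin N} {j : Fin n}
    (h : a i j = 0) (x : Fin n → ℂ) (z : ℂ) :
    rowForm a i (Function.update x j z) = rowForm a i x := by
  unfold rowForm
  refine Finset.sum_congr rfl fun k _ => ?_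
  by_cases hk : k = j
  · subst hk; simp [h]
  · simp [hk]

theorem HypH.re_nonneg {N n : ℕ} {a : Fin N → Fin n → ℂ} (h : HypH a) (i : Fin N) (j : Fin n) :
    0 ≤ (a i j).re := by
  rcases h.1 i j with h | h
  · simp [h]
  · exact h.le

theorem HypH.re_rowForm_nonneg {N n : ℕ} {a : Fin N → Fin n → ℂ} (h : HypH a) (i : Fin N)
    {x : Fin n → ℂ} (hx : x ∈ unitBox n) : 0 ≤ (rowForm a i x).re := by
  unfold rowForm
  rw [Complex.re_sum]
  refine Finset.sum_nonneg fun k _ => ?_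
  obtain ⟨r, h0, -, hr⟩ := mem_unitBox_re hx k
  rw [hr, Complex.re_mul_ofReal]
  exact mul_nonneg (h.re_nonneg i k) h0

theorem HypH.rowForm_update_one_ne_zero {N n : ℕ} {a : Fin N → Fin n → ℂ} (h : HypH a)
    {i : Fin N} {j : Fin n} (hij : a i j ≠ 0) {x : Fin n → ℂ} (hx : x ∈ unitBox n) :
    rowForm a i (Function.update x j 1) ≠ 0 := by
  have hpos : 0 < (rowForm a i (Function.update x j 1)).re := by
    unfold rowForm
    rw [Complex.re_sum]
    refine Finset.sum_pos' (fun k _ => ?_) ⟨j, Finset.mem_univ j, ?_⟩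
    · obtain ⟨r, h0, -, hr⟩ := mem_unitBox_re (update_mem_unitBox hx j) k
      rw [hr, Complex.re_mul_ofReal]
      exact mul_nonneg (h.re_nonneg i k) h0
    · simpa using (h.1 i j).resolve_left hij
  intro h0
  simp [h0] at hpos

theorem analyticAt_apply {n : ℕ} (k : Fin n) (x : Fin n → ℂ) :
    AnalyticAt ℂ (fun x : Fin n → ℂ => x k) x :=
  (ContinuousLinearMap.proj (R := ℂ) (φ := fun _ : Fin n => ℂ) k).analyticAt x

theorem analyticAt_blowUp {n : ℕ} (S : Finset (Fin n)) (j : Fin n) (x : Fin n → ℂ) :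
    AnalyticAt ℂ (blowUp S j) x := by
  refine AnalyticAt.pi fun k => ?_
  unfold blowUp
  split_ifs
  · exact (analyticAt_apply k x).mul (analyticAt_apply j x)
  · exact analyticAt_apply k x

theorem analyticAt_update {n : ℕ} (j : Fin n) (z : ℂ) (x : Fin n → ℂ) :
    AnalyticAt ℂ (fun x => Function.update x j z) x := by
  refine AnalyticAt.pi fun k => ?_
  by_cases h : k = j
  · subst h
    simpa using analyticAt_const
  · simpa only [Function.update_of_ne h] using analyticAt_apply k x

theorem analyticAt_rowForm {N n : ℕ} (a : Fin N → Fin n → ℂ) (i : Fin N) (x : Fin n → ℂ) :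
    AnalyticAt ℂ (rowForm a i) x := by
  unfold rowForm
  exact Finset.analyticAt_fun_sum _ fun k _ => analyticAt_const.mul (analyticAt_apply k x)

/-- The amplitude after restricting to the chamber of `j`. -/
def chamberAmplitude {N n : ℕ} (a : Fin N → Fin n → ℂ) (S : Finset (Fin n)) (R : Finset (Fin N))
    (j : Fin n) (G : (ℂ × (Fin n → ℂ)) × (Fin n → ℂ) → ℂ)
    (z : (ℂ × (Fin n → ℂ)) × (Fin n → ℂ)) : ℂ :=
  (∏ i ∈ R with a i j ≠ 0, (rowForm a i (Function.update z.2 j 1))⁻¹) * G (z.1, blowUp S j z.2)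

theorem Amplitude.chamberAmplitude {N n : ℕ} {a : Fin N → Fin n → ℂ} (h : HypH a)
    (S : Finset (Fin n)) (R : Finset (Fin N)) (j : Fin n)
    {G : (ℂ × (Fin n → ℂ)) × (Fin n → ℂ) → ℂ} (hG : Amplitude G) :
    Amplitude (chamberAmplitude a S R j G) := by
  rintro ⟨p, x⟩ ⟨hp, hx⟩
  refine AnalyticAt.mul ?_ ?_
  · refine Finset.analyticAt_fun_prod _ fun i hi => AnalyticAt.inv ?_
      (h.rowForm_update_one_ne_zero (Finset.mem_filter.1 hi).2 hx)
    exact AnalyticAt.comp (g := fun x => rowForm a i (Function.update x j 1)) (f := Prod.snd)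
      (AnalyticAt.comp (g := rowForm a i) (f := fun x => Function.update x j 1)
        (analyticAt_rowForm a i _) (analyticAt_update j 1 _)) analyticAt_snd
  · refine AnalyticAt.comp (g := G) (f := fun z : (ℂ × (Fin n → ℂ)) × (Fin n → ℂ) =>
      (z.1, blowUp S j z.2)) (hG _ ⟨hp, blowUp_mem S j hx⟩) (analyticAt_fst.prod ?_)
    exact AnalyticAt.comp (analyticAt_blowUp S j _) analyticAt_snd

theorem kernel_chamberShear {N n : ℕ} {a : Fin N → Fin n → ℂ} {S : Finset (Fin n)}
    {R : Finset (Fin N)} {b : Fin n → ℕ} {c : Fin n → ℤ} (hb : ∀ k ∈ S, b k = 1 ∧ c k = 0)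
    (hR : ∀ i ∈ R, ∀ k, a i k ≠ 0 → k ∈ S) {j : Fin n} (hj : j ∈ S)
    (G : (ℂ × (Fin n → ℂ)) × (Fin n → ℂ) → ℂ) (p : ℂ × (Fin n → ℂ)) (σ : Fin n → ℝ) :
    kernel (affineExp b c p.1) (fun x => (∏ i ∈ R, (rowForm a i x)⁻¹) * G (p, x))
      (chamberShear S j σ) =
    kernel (affineExp (Function.update b j S.card) (Function.update c j R.card) p.1)
      (fun x => (∏ i ∈ R with a i j = 0, (rowForm a i x)⁻¹) *
        chamberAmplitude a S R j G (p, x)) σ := by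
  have hexp : -∑ k, affineExp b c p.1 k * (chamberShear S j σ k : ℝ) + R.card * σ j =
      -∑ k, affineExp (Function.update b j S.card) (Function.update c j R.card) p.1 k * σ k := by
    have h1 : ∑ k, affineExp b c p.1 k * (chamberShear S j σ k : ℝ) =
        ∑ k, affineExp b c p.1 k * σ k + ∑ k ∈ S.erase j, affineExp b c p.1 k * σ j := by
      rw [← Finset.sum_filter_add_sum_filter_not Finset.univ (· ∈ S.erase j)
        (fun k => affineExp b c p.1 k * (chamberShear S j σ k : ℝ)),
        ← Finset.sum_filter_add_sum_filter_not Finset.univ (· ∈ S.erase j)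
        (fun k => affineExp b c p.1 k * (σ k : ℂ)), Finset.filter_mem_eq_inter,
        Finset.univ_inter, add_right_comm, ← Finset.sum_add_distrib]
      congr 1
      · refine Finset.sum_congr rfl fun k hk => ?_
        simp only [chamberShear, hk, if_true]
        push_cast
        ring
      · refine Finset.sum_congr rfl fun k hk => ?_
        simp only [chamberShear, (Finset.mem_filter.1 hk).2, if_false]
    have h2 : ∑ k ∈ S.erase j, affineExp b c p.1 k * (σ j : ℂ) = (S.card - 1) * (p.1 * σ j) := by
      have : ∀ k ∈ S.erase j, affineExp b c p.1 k * (σ j : ℂ) = p.1 * σ j := by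
        intro k hk
        simp [affineExp, hb k (Finset.mem_of_mem_erase hk)]
      rw [Finset.sum_congr rfl this, Finset.sum_const, Finset.card_erase_of_mem hj, nsmul_eq_mul,
        Nat.cast_sub (Finset.card_pos.2 ⟨j, hj⟩), Nat.cast_one]
    have h3 : ∑ k, affineExp (Function.update b j S.card) (Function.update c j R.card) p.1 k * σ k =
        ∑ k, affineExp b c p.1 k * σ k + (S.card * p.1 - R.card - p.1) * σ j := by
      rw [← sub_eq_iff_eq_add', ← Finset.sum_sub_distrib, Finset.sum_eq_single j]
      · simp [affineExp, hb j hj]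
        ring
      · intro k _ hk
        simp [affineExp, hk]
      · simp
    rw [h1, h2, h3]
    ring
  have hrow : ∏ i ∈ R, (rowForm a i (blowUp S j (expNeg σ)))⁻¹ = cexp (R.card * σ j) *
      ((∏ i ∈ R with a i j = 0, (rowForm a i (expNeg σ))⁻¹) *
        ∏ i ∈ R with a i j ≠ 0, (rowForm a i (Function.update (expNeg σ) j 1))⁻¹) := by
    have h1 : ∀ i ∈ R, (rowForm a i (blowUp S j (expNeg σ)))⁻¹ =
        cexp (σ j) * (rowForm a i (Function.update (expNeg σ) j 1))⁻¹ := by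
      intro i hi
      rw [rowForm_blowUp (hR i hi), mul_inv]
      simp only [expNeg, ← Complex.exp_neg, neg_neg]
    rw [Finset.prod_congr rfl h1, Finset.prod_mul_distrib, Finset.prod_const, ← Complex.exp_nat_mul,
      ← Finset.prod_filter_mul_prod_filter_not R (fun i => a i j = 0)]
    congr 2
    refine Finset.prod_congr rfl fun i hi => ?_
    rw [rowForm_update (Finset.mem_filter.1 hi).2]
  unfold kernel chamberAmplitude
  rw [expNeg_chamberShear]
  dsimp only
  rw [hrow, ← hexp, Complex.exp_add]
  ring

/-- The rational points where poles are permitted. -/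
def IsPermitted (N n Z : ℕ) (s : ℂ) : Prop :=
  s.im = 0 ∧ s.re ≤ (N : ℝ) / ((n : ℝ) - (Z : ℝ)) ∧
    ∃ A B : ℤ, (n : ℤ) - (Z : ℤ) ≤ B ∧ B ≤ (n : ℤ) ∧ s = (A : ℂ) / (B : ℂ)

/-- The pole bounds for one summand of `Γ(s)ⁿ ζ(s, w)`. -/
def HasPermittedPoles (N n Z : ℕ) (H : ℂ × (Fin n → ℂ) → ℂ) : Prop :=
  ∀ p ∈ rightDomain n, HasPoleOrderAt n H p ∧ ((∀ l : ℕ, p.1 ≠ -l) → HasPoleOrderAt (Z + 1) H p ∧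
    (¬ IsPermitted N n Z p.1 → HasPoleOrderAt 0 H p))

theorem HasPermittedPoles.sum {N n Z : ℕ} {ι : Type*} (t : Finset ι)
    {H : ι → ℂ × (Fin n → ℂ) → ℂ} (h : ∀ i ∈ t, HasPermittedPoles N n Z (H i)) :
    HasPermittedPoles N n Z fun p => ∑ i ∈ t, H i p := fun p hp =>
  ⟨.sum t fun i hi => (h i hi p hp).1, fun hl =>
    ⟨.sum t fun i hi => ((h i hi p hp).2 hl).1, fun hs =>
      .sum t fun i hi => ((h i hi p hp).2 hl).2 hs⟩⟩

theorem isPermitted_of_affineExp {N n Z : ℕ} (hZ : Z < n) {b : ℕ} {c : ℤ} {l : ℕ} {s : ℂ}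
    (hb : n - Z ≤ b) (hbn : b ≤ n) (hc : c ≤ N) (h : (b : ℂ) * s - c = -l) :
    IsPermitted N n Z s := by
  have hb0 : 0 < b := by omega
  have hs : s = ((c - l : ℤ) : ℂ) / ((b : ℤ) : ℂ) := by
    have : (b : ℂ) ≠ 0 := by exact_mod_cast hb0.ne'
    rw [eq_div_iff (by exact_mod_cast hb0.ne')]
    push_cast
    linear_combination h
  have hs' : s = (((c - l : ℤ) / (b : ℤ) : ℝ) : ℂ) := by rw [hs]; push_cast; rfl
  have hd : (0 : ℝ) < (n : ℝ) - Z := sub_pos.2 (by exact_mod_cast hZ)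
  have hbR : (n : ℝ) - Z ≤ b := by
    rw [sub_le_iff_le_add]; exact_mod_cast (by omega : n ≤ b + Z)
  refine ⟨by rw [hs', Complex.ofReal_im], ?_, c - l, b, by omega, by omega, hs⟩
  rw [hs', Complex.ofReal_re]
  refine (div_le_div_of_nonneg_right (b := (N : ℝ)) ?_ (by positivity)).trans ?_
  · push_cast
    have : (c : ℝ) ≤ N := by exact_mod_cast hc
    have : (0 : ℝ) ≤ l := by positivity
    linarith
  · exact div_le_div_of_nonneg_left (by positivity) hd (by exact_mod_cast hbR)

/-- Exponent data attached to a chain of chambers with active coordinates `S`. -/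
structure ChamberData (N : ℕ) {n : ℕ} (Z : ℕ) (S : Finset (Fin n)) (b : Fin n → ℕ)
    (c : Fin n → ℤ) : Prop where
  active : ∀ k ∈ S, b k = 1 ∧ c k = 0
  inactive : ∀ k ∉ S, (b k = 0 ∧ c k = -1) ∨ (n - Z ≤ b k ∧ b k ≤ n ∧ c k ≤ N)
  card_le : (Finset.univ.filter fun k => k ∉ S ∧ b k ≠ 0).card ≤ Z + 1

namespace ChamberData

variable {N n Z : ℕ} {S : Finset (Fin n)} {b : Fin n → ℕ} {c : Fin n → ℤ}

theorem neg_of_eq_zero (h : ChamberData N Z S b c) (hZ : Z < n) (k : Fin n) (hk : b k = 0) :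
    c k < 0 := by
  by_cases hS : k ∈ S
  · have := (h.active k hS).1
    omega
  · rcases h.inactive k hS with h | h <;> omega

theorem re_affineExp_pos (h : ChamberData N Z S b c) (hZ : Z < n) {s : ℂ}
    (hs : (N : ℝ) / ((n : ℝ) - (Z : ℝ)) < s.re) (k : Fin n) : 0 < (affineExp b c s k).re := by
  have hd : (0 : ℝ) < (n : ℝ) - Z := sub_pos.2 (by exact_mod_cast hZ)
  have hs0 : 0 < s.re := lt_of_le_of_lt (by positivity) hs
  have hre : (affineExp b c s k).re = b k * s.re - c k := by simp [affineExp]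
  rw [hre]
  by_cases hS : k ∈ S
  · simpa [h.active k hS] using hs0
  · rcases h.inactive k hS with h | ⟨h1, h2, h3⟩
    · simp [h.1, h.2]
    · have hbR : (n : ℝ) - Z ≤ b k := by
        rw [sub_le_iff_le_add]; exact_mod_cast (by omega : n ≤ b k + Z)
      rw [div_lt_iff₀' hd] at hs
      have h4 : (c k : ℝ) ≤ N := by exact_mod_cast h3
      nlinarith

theorem hasPermittedPoles (h : ChamberData N Z S b c) (hZ : Z < n) {H : ℂ × (Fin n → ℂ) → ℂ}
    (hH : ∀ p ∈ rightDomain n, HasPoleOrderAt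
      (Finset.univ.filter fun k => ∃ l : ℕ, affineExp b c p.1 k = -l).card H p) :
    HasPermittedPoles N n Z H := by
  intro p hp
  refine ⟨(hH p hp).mono ((Finset.card_le_univ _).trans (by simp)), fun hl => ?_⟩
  have hsub : ∀ k, (∃ l : ℕ, affineExp b c p.1 k = -l) → k ∉ S ∧ b k ≠ 0 := by
    rintro k ⟨l, hkl⟩
    refine ⟨fun hS => hl l ?_, fun hb => ?_⟩
    · simpa [affineExp, h.active k hS] using hkl
    · have hc := h.neg_of_eq_zero hZ k hb
      have : c k = l := by
        have : (c k : ℂ) = l := by simpa [affineExp, hb] using hkl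
        exact_mod_cast this
      omega
  refine ⟨(hH p hp).mono (le_trans (Finset.card_le_card ?_) h.card_le), fun hs => ?_⟩
  · intro k hk
    simp only [Finset.mem_filter, Finset.mem_univ, true_and] at hk ⊢
    exact hsub k hk
  · convert hH p hp
    symm
    rw [Finset.card_eq_zero, Finset.filter_eq_empty_iff]
    rintro k - hk
    obtain ⟨hS, hb⟩ := hsub k hk
    obtain ⟨l, hkl⟩ := hk
    rcases h.inactive k hS with h | ⟨h1, h2, h3⟩
    · exact hb h.1
    · exact hs (isPermitted_of_affineExp hZ h1 h2 h3 hkl)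

theorem step (h : ChamberData N Z S b c) (hS : n - Z ≤ S.card) {j : Fin n} (hj : j ∈ S)
    (R : Finset (Fin N)) : ChamberData N Z (S.erase j) (Function.update b j S.card)
      (Function.update c j R.card) where
  active k hk := by
    obtain ⟨h1, h2⟩ := Finset.mem_erase.1 hk
    simpa [h1] using h.active k h2
  inactive k hk := by
    by_cases hkj : k = j
    · subst hkj
      right
      have h1 := Finset.card_le_univ S
      have h2 := Finset.card_le_univ R
      simp only [Fintype.card_fin] at h1 h2
      simp only [Function.update_self]
      exact ⟨hS, h1, by exact_mod_cast h2⟩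
    · simpa [hkj] using h.inactive k fun h => hk (Finset.mem_erase.2 ⟨hkj, h⟩)
  card_le := by
    have h1 : (Finset.univ.filter fun k => k ∉ S.erase j ∧ Function.update b j S.card k ≠ 0) ⊆
        (S.erase j)ᶜ := by
      intro k hk
      simpa only [Finset.mem_compl] using (Finset.mem_filter.1 hk).2.1
    have h2 := Finset.card_le_card h1
    rw [Finset.card_compl, Finset.card_erase_of_mem hj, Fintype.card_fin] at h2
    have := Finset.card_pos.2 ⟨j, hj⟩
    omega

end ChamberData

theorem exists_continuation_of_rows {N n Z : ℕ} (hZ : Z < n) {a : Fin N → Fin n → ℂ}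
    (ha : HypH a) (hrow : ∀ i, (Finset.univ.filter fun j => a i j = 0).card ≤ Z) (m : ℕ) :
    ∀ (S : Finset (Fin n)) (R : Finset (Fin N)) (b : Fin n → ℕ) (c : Fin n → ℤ)
      (G : (ℂ × (Fin n → ℂ)) × (Fin n → ℂ) → ℂ), S.card = m → ChamberData N Z S b c →
      (∀ i ∈ R, ∀ k, a i k ≠ 0 → k ∈ S) → Amplitude G →
      ∃ H : ℂ × (Fin n → ℂ) → ℂ, HasPermittedPoles N n Z H ∧ ∀ p ∈ rightDomain n,
        (N : ℝ) / ((n : ℝ) - (Z : ℝ)) < p.1.re →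
        Integrable (kernel (affineExp b c p.1)
          fun x => (∏ i ∈ R, (rowForm a i x)⁻¹) * G (p, x)) (orthant n) ∧
        H p = ∫ τ, kernel (affineExp b c p.1)
          (fun x => (∏ i ∈ R, (rowForm a i x)⁻¹) * G (p, x)) τ ∂(orthant n) := by
  induction m using Nat.strong_induction_on with
  | _ m ih =>
    intro S R b c G hS hD hR hG
    rcases R.eq_empty_or_nonempty with rfl | ⟨i, hi⟩
    · obtain ⟨H, h1, h2⟩ := exists_continuation_of_amplitude b c (hD.neg_of_eq_zero hZ) hG
      refine ⟨H, hD.hasPermittedPoles hZ h2, fun p hp hs => ?_⟩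
      have hpos := hD.re_affineExp_pos hZ hs
      simp only [Finset.prod_empty, one_mul]
      exact ⟨integrable_kernel hpos (hG.continuousOn hp), h1 p hp hpos⟩
    have hSc : n - Z ≤ S.card := by
      have h1 : (Finset.univ.filter fun j => ¬ a i j = 0) ⊆ S := fun k hk =>
        hR i hi k (Finset.mem_filter.1 hk).2
      have h2 := Finset.card_le_card h1
      have h3 := Finset.card_filter_add_card_filter_not (s := (Finset.univ : Finset (Fin n)))
        (fun j => a i j = 0)
      have h4 := hrow i
      simp only [Finset.card_univ, Fintype.card_fin] at h3
      omega
    have hSn : S.Nonempty := Finset.card_pos.1 (by omega)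
    have key : ∀ j : S, ∃ H : ℂ × (Fin n → ℂ) → ℂ, HasPermittedPoles N n Z H ∧
        ∀ p ∈ rightDomain n, (N : ℝ) / ((n : ℝ) - (Z : ℝ)) < p.1.re →
        Integrable (kernel (affineExp (Function.update b j S.card) (Function.update c j R.card) p.1)
          fun x => (∏ i ∈ R with a i j = 0, (rowForm a i x)⁻¹) *
            chamberAmplitude a S R j G (p, x)) (orthant n) ∧
        H p = ∫ τ, kernel
          (affineExp (Function.update b j S.card) (Function.update c j R.card) p.1)
          (fun x => (∏ i ∈ R with a i j = 0, (rowForm a i x)⁻¹) *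
            chamberAmplitude a S R j G (p, x)) τ ∂(orthant n) := by
      rintro ⟨j, hj⟩
      refine ih (S.erase j).card (hS ▸ Finset.card_erase_lt_of_mem hj) (S.erase j) _ _ _ _ rfl
        (hD.step hSc hj R) (fun i hi k hk => ?_) (hG.chamberAmplitude ha S R j)
      obtain ⟨h1, h2⟩ := Finset.mem_filter.1 hi
      exact Finset.mem_erase.2 ⟨fun h => hk (h ▸ h2), hR i h1 k hk⟩
    choose H hH1 hH2 using key
    refine ⟨fun p => ∑ j ∈ S.attach, H j p, .sum _ fun j _ => hH1 j, fun p hp hs => ?_⟩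
    have := integral_orthant_eq_sum_chamber (S := S) hSn (f := kernel (affineExp b c p.1)
          fun x => (∏ i ∈ R, (rowForm a i x)⁻¹) * G (p, x)) fun j hj => by
      simp only [kernel_chamberShear hD.active hR hj]
      exact (hH2 ⟨j, hj⟩ p hp hs).1
    refine ⟨this.1, ?_⟩
    rw [this.2, ← Finset.sum_attach S]
    refine Finset.sum_congr rfl fun j _ => ?_
    simp only [kernel_chamberShear hD.active hR j.2]
    exact (hH2 j p hp hs).2

/-- The product of Lebesgue measures on `(1, ∞)`. -/
def upperOrthant (n : ℕ) : Measure (Fin n → ℝ) := Measure.pi fun _ => volume.restrict (Set.Ioi 1)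

instance (n : ℕ) : SigmaFinite (upperOrthant n) := by unfold upperOrthant; infer_instance

theorem ae_upperOrthant (n : ℕ) : ∀ᵐ y ∂(upperOrthant n), ∀ k, 1 < y k := by
  rw [upperOrthant, ← Measure.restrict_pi_pi]
  filter_upwards [ae_restrict_mem (MeasurableSet.univ_pi fun _ => measurableSet_Ioi)] with y h k
  exact h k trivial

/-- The vector with coordinates `y_j` for `j ∈ B` and `x_j` otherwise. -/
def mix {n : ℕ} (B : Finset (Fin n)) (y : Fin n → ℝ) (x : Fin n → ℂ) : Fin n → ℂ :=
  fun j => if j ∈ B then (y j : ℂ) else x j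

/-- The rows that vanish on the columns of `B`. -/
def rowsVanishingOn {N n : ℕ} (a : Fin N → Fin n → ℂ) (B : Finset (Fin n)) : Finset (Fin N) :=
  Finset.univ.filter fun i => ∀ j ∈ B, a i j = 0

/-- The integrand over the large variables `y_j`, `j ∈ B`. -/
def largeIntegrand {N n : ℕ} (a : Fin N → Fin n → ℂ) (B : Finset (Fin n))
    (z : (ℂ × (Fin n → ℂ)) × (Fin n → ℂ)) (y : Fin n → ℝ) : ℂ :=
  (∏ j, if j ∈ B then (y j : ℂ) ^ (z.1.1 - 1) * cexp (-(z.1.2 j * y j))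
    else cexp (1 - y j) * cexp (-(z.1.2 j * z.2 j))) *
  ∏ i ∈ (rowsVanishingOn a B)ᶜ, (1 - cexp (-rowForm a i (mix B y z.2)))⁻¹

/-- The analytic function `z ↦ (1 - e^{-z}) / z`. -/
def expSlope : ℂ → ℂ := dslope (fun z => 1 - cexp (-z)) 0

theorem analyticAt_expSlope (z : ℂ) : AnalyticAt ℂ expSlope z := by
  have h : Differentiable ℂ expSlope := by
    rw [← differentiableOn_univ]
    unfold expSlope
    rw [Complex.differentiableOn_dslope Filter.univ_mem, differentiableOn_univ]
    fun_prop
  exact h.analyticAt z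

theorem expSlope_zero : expSlope 0 = 1 := by
  have h : HasDerivAt (fun z : ℂ => 1 - cexp (-z)) 1 0 := by
    have := ((hasDerivAt_id (0 : ℂ)).neg.cexp).const_sub 1
    simpa using this
  rw [expSlope, dslope_same, h.deriv]

theorem expSlope_of_ne {z : ℂ} (hz : z ≠ 0) : expSlope z = (1 - cexp (-z)) / z := by
  rw [expSlope, dslope_of_ne _ hz, slope_def_field]
  simp

theorem one_sub_norm_le {z : ℂ} {η : ℝ} (h : η ≤ z.re) :
    1 - Real.exp (-η) ≤ ‖1 - cexp (-z)‖ := by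
  have h1 := norm_sub_norm_le (1 : ℂ) (cexp (-z))
  rw [norm_one, Complex.norm_exp, Complex.neg_re] at h1
  have h2 : Real.exp (-z.re) ≤ Real.exp (-η) := Real.exp_le_exp.2 (neg_le_neg h)
  linarith

theorem one_sub_exp_ne_zero {z : ℂ} (h : 0 < z.re) : 1 - cexp (-z) ≠ 0 := by
  rw [← norm_pos_iff]
  refine lt_of_lt_of_le ?_ (one_sub_norm_le le_rfl)
  simpa using h

theorem norm_inv_one_sub_exp_le {z : ℂ} {η : ℝ} (hη : 0 < η) (h : η ≤ z.re) :
    ‖(1 - cexp (-z))⁻¹‖ ≤ (1 - Real.exp (-η))⁻¹ := by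
  rw [norm_inv]
  refine inv_anti₀ ?_ (one_sub_norm_le h)
  simpa using hη

theorem inv_one_sub_exp {z : ℂ} : (1 - cexp (-z))⁻¹ = z⁻¹ * (expSlope z)⁻¹ := by
  by_cases hz : z = 0
  · simp [hz]
  · rw [expSlope_of_ne hz, inv_div, div_eq_mul_inv, inv_mul_cancel_left₀ hz]

theorem HypH.expSlope_rowForm_ne_zero {N n : ℕ} {a : Fin N → Fin n → ℂ} (h : HypH a) (i : Fin N)
    {x : Fin n → ℂ} (hx : x ∈ unitBox n) : expSlope (rowForm a i x) ≠ 0 := by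
  by_cases h0 : rowForm a i x = 0
  · simp [h0, expSlope_zero]
  rw [expSlope_of_ne h0]
  refine div_ne_zero (one_sub_exp_ne_zero ?_) h0
  refine (h.re_rowForm_nonneg i hx).lt_of_ne fun hre => h0 ?_
  unfold rowForm at hre ⊢
  rw [Complex.re_sum, eq_comm, Finset.sum_eq_zero_iff_of_nonneg] at hre
  · refine Finset.sum_eq_zero fun j hj => ?_
    have h1 := hre j hj
    obtain ⟨r, h0, -, hr⟩ := mem_unitBox_re hx j
    rw [hr, Complex.re_mul_ofReal, mul_eq_zero] at h1
    rcases h1 with h1 | h1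
    · rw [(h.1 i j).resolve_right (by simp [h1]), zero_mul]
    · rw [hr, h1]; simp
  · intro j _
    obtain ⟨r, h0, -, hr⟩ := mem_unitBox_re hx j
    rw [hr, Complex.re_mul_ofReal]
    exact mul_nonneg (h.re_nonneg i j) h0

theorem measurable_largeIntegrand {N n : ℕ} (a : Fin N → Fin n → ℂ) (B : Finset (Fin n))
    (z : (ℂ × (Fin n → ℂ)) × (Fin n → ℂ)) : Measurable (largeIntegrand a B z) := by
  unfold largeIntegrand
  refine Measurable.mul (Finset.measurable_fun_prod _ fun j _ => ?_)
    (Finset.measurable_fun_prod _ fun i _ => ?_)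
  · split_ifs <;> fun_prop
  · refine Measurable.inv (Measurable.sub measurable_const (Measurable.cexp (Measurable.neg ?_)))
    unfold rowForm mix
    refine Finset.measurable_fun_sum _ fun j _ => Measurable.mul measurable_const ?_
    split_ifs <;> fun_prop

theorem analyticAt_largeIntegrand {N n : ℕ} (a : Fin N → Fin n → ℂ) (B : Finset (Fin n))
    {z : (ℂ × (Fin n → ℂ)) × (Fin n → ℂ)} {y : Fin n → ℝ} (hy : ∀ j, 1 < y j)
    (hz : ∀ i ∈ (rowsVanishingOn a B)ᶜ, 0 < (rowForm a i (mix B y z.2)).re) :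
    AnalyticAt ℂ (fun z => largeIntegrand a B z y) z := by
  have hw : ∀ j, AnalyticAt ℂ (fun z : (ℂ × (Fin n → ℂ)) × (Fin n → ℂ) => z.1.2 j) z := fun j =>
    ((ContinuousLinearMap.proj (R := ℂ) (φ := fun _ : Fin n => ℂ) j).comp
      ((ContinuousLinearMap.snd ℂ ℂ (Fin n → ℂ)).comp
        (ContinuousLinearMap.fst ℂ (ℂ × (Fin n → ℂ)) (Fin n → ℂ)))).analyticAt z
  have hx : ∀ j, AnalyticAt ℂ (fun z : (ℂ × (Fin n → ℂ)) × (Fin n → ℂ) => z.2 j) z := fun j =>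
    ((ContinuousLinearMap.proj (R := ℂ) (φ := fun _ : Fin n => ℂ) j).comp
        (ContinuousLinearMap.snd ℂ (ℂ × (Fin n → ℂ)) (Fin n → ℂ))).analyticAt z
  have hs : AnalyticAt ℂ (fun z : (ℂ × (Fin n → ℂ)) × (Fin n → ℂ) => z.1.1) z :=
    ((ContinuousLinearMap.fst ℂ ℂ (Fin n → ℂ)).comp
        (ContinuousLinearMap.fst ℂ (ℂ × (Fin n → ℂ)) (Fin n → ℂ))).analyticAt z
  unfold largeIntegrand
  refine AnalyticAt.mul (Finset.analyticAt_fun_prod _ fun j _ => ?_)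
    (Finset.analyticAt_fun_prod _ fun i hi => ?_)
  · split_ifs
    · refine AnalyticAt.mul ?_ ((hw j).mul analyticAt_const).neg.cexp
      exact analyticAt_const.cpow (hs.sub analyticAt_const)
        (Complex.ofReal_mem_slitPlane.2 (zero_lt_one.trans (hy j)))
    · exact analyticAt_const.mul ((hw j).mul (hx j)).neg.cexp
  · refine AnalyticAt.inv (analyticAt_const.sub (AnalyticAt.neg ?_).cexp)
      (one_sub_exp_ne_zero (hz i hi))
    unfold rowForm mix
    refine Finset.analyticAt_fun_sum _ fun j _ => analyticAt_const.mul ?_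
    split_ifs
    · exact analyticAt_const
    · exact hx j

theorem integrableOn_rpow_mul_exp {σ δ : ℝ} (hσ : 0 ≤ σ) (hδ : 0 < δ) :
    IntegrableOn (fun y : ℝ => y ^ σ * Real.exp (-(δ * y))) (Set.Ioi 1) := by
  have := integrableOn_rpow_mul_exp_neg_mul_rpow (p := 1) (s := σ) (by linarith) one_pos hδ
  refine (this.mono_set (Set.Ioi_subset_Ioi zero_le_one)).congr_fun (fun y _ => ?_)
    measurableSet_Ioi
  simp

theorem exists_pos_lt_re_rowForm_mix {N n : ℕ} {a : Fin N → Fin n → ℂ} (h : HypH a)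
    {B : Finset (Fin n)} {i : Fin N} (hi : i ∈ (rowsVanishingOn a B)ᶜ) {x₀ : Fin n → ℂ}
    (hx₀ : x₀ ∈ unitBox n) : ∃ η > 0, ∀ᶠ x in nhds x₀, ∀ y : Fin n → ℝ, (∀ j, 1 < y j) →
      η < (rowForm a i (mix B y x)).re := by
  have hi' : ∃ j ∈ B, a i j ≠ 0 := by simpa [rowsVanishingOn] using hi
  obtain ⟨j₀, hj₀, hne⟩ := hi'
  have hc : 0 < (a i j₀).re := (h.1 i j₀).resolve_left hne
  refine ⟨(a i j₀).re / 2, half_pos hc, ?_⟩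
  set f : (Fin n → ℂ) → ℝ := fun x => (∑ j ∈ Bᶜ, a i j * x j).re with hf
  have hf0 : 0 ≤ f x₀ := by
    simp only [hf, Complex.re_sum]
    refine Finset.sum_nonneg fun j _ => ?_
    obtain ⟨r, h0, -, hr⟩ := mem_unitBox_re hx₀ j
    rw [hr, Complex.re_mul_ofReal]
    exact mul_nonneg (h.re_nonneg i j) h0
  have hfc : Continuous f := Complex.continuous_re.comp (by fun_prop)
  filter_upwards [hfc.continuousAt.eventually (eventually_gt_nhds
    (show -((a i j₀).re / 2) < f x₀ by linarith [half_pos hc]))] with x hx y hy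
  have h1 : rowForm a i (mix B y x) = ∑ j ∈ B, a i j * y j + ∑ j ∈ Bᶜ, a i j * x j := by
    rw [rowForm, ← Finset.sum_add_sum_compl B]
    congr 1
    · exact Finset.sum_congr rfl fun j hj => by simp [mix, hj]
    · exact Finset.sum_congr rfl fun j hj => by simp [mix, Finset.mem_compl.1 hj]
  have h2 : (a i j₀).re ≤ (∑ j ∈ B, a i j * (y j : ℂ)).re := by
    rw [Complex.re_sum]
    simp only [Complex.re_mul_ofReal]
    refine le_trans ?_ (Finset.single_le_sum (f := fun j => (a i j).re * y j)
      (fun j _ => mul_nonneg (h.re_nonneg i j) (zero_lt_one.trans (hy j)).le) hj₀)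
    exact le_mul_of_one_le_right hc.le (hy j₀).le
  rw [h1, Complex.add_re]
  have h3 : -((a i j₀).re / 2) < (∑ j ∈ Bᶜ, a i j * x j).re := hx
  linarith

theorem exists_bound_largeIntegrand {N n : ℕ} {a : Fin N → Fin n → ℂ} (h : HypH a)
    (B : Finset (Fin n)) {z₀ : (ℂ × (Fin n → ℂ)) × (Fin n → ℂ)}
    (hz₀ : z₀ ∈ rightDomain n ×ˢ unitBox n) :
    ∃ U ∈ nhds z₀, ∃ bound, Integrable bound (upperOrthant n) ∧
      ∀ᵐ y ∂(upperOrthant n), ∀ z ∈ U, AnalyticAt ℂ (fun z => largeIntegrand a B z y) z ∧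
        ‖largeIntegrand a B z y‖ ≤ bound y := by
  obtain ⟨⟨s₀, w₀⟩, x₀⟩ := z₀
  obtain ⟨hp₀, hx₀⟩ := hz₀
  obtain ⟨δ, hδ, hδw⟩ := exists_lt_forall_lt_re (β := w₀) hp₀
  choose! η hη0 hη using fun i (hi : i ∈ (rowsVanishingOn a B)ᶜ) =>
    exists_pos_lt_re_rowForm_mix h hi hx₀
  set z₀ : (ℂ × (Fin n → ℂ)) × (Fin n → ℂ) := ((s₀, w₀), x₀) with hz₀
  have e1 : ∀ᶠ z in nhds z₀, ∀ j, δ < (z.1.2 j).re := Filter.eventually_all.2 fun j =>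
    (Continuous.continuousAt (f := fun z : (ℂ × (Fin n → ℂ)) × (Fin n → ℂ) => (z.1.2 j).re)
      (Complex.continuous_re.comp (by fun_prop))).eventually (eventually_gt_nhds (hδw j))
  have e2 : ∀ᶠ z in nhds z₀, ∀ j, ‖z.1.2 j * z.2 j‖ < ‖w₀ j * x₀ j‖ + 1 :=
    Filter.eventually_all.2 fun j =>
    (Continuous.continuousAt (f := fun z : (ℂ × (Fin n → ℂ)) × (Fin n → ℂ) => ‖z.1.2 j * z.2 j‖)
      (by fun_prop)).eventually (eventually_lt_nhds (lt_add_one _))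
  have e3 : ∀ᶠ z in nhds z₀, z.1.1.re < |s₀.re| + 1 :=
    (Continuous.continuousAt (f := fun z : (ℂ × (Fin n → ℂ)) × (Fin n → ℂ) => z.1.1.re)
      (Complex.continuous_re.comp (by fun_prop))).eventually (eventually_lt_nhds
        ((le_abs_self _).trans_lt (lt_add_one _)))
  have e4 : ∀ᶠ z in nhds z₀, ∀ i ∈ (rowsVanishingOn a B)ᶜ, ∀ y : Fin n → ℝ, (∀ j, 1 < y j) →
      η i < (rowForm a i (mix B y z.2)).re :=
    (Filter.eventually_all_finset _).2 fun i hi => (continuous_snd.tendsto z₀).eventually (hη i hi)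
  refine ⟨_, Filter.inter_mem (Filter.inter_mem e1 e2) (Filter.inter_mem e3 e4),
    fun y => (∏ j, (fun j t => if j ∈ B then t ^ (|s₀.re| + 1) * Real.exp (-(δ * t))
      else Real.exp (1 - t) * Real.exp (‖w₀ j * x₀ j‖ + 1)) j (y j)) *
      ∏ i ∈ (rowsVanishingOn a B)ᶜ, (1 - Real.exp (-η i))⁻¹, ?_, ?_⟩
  · refine Integrable.mul_const ?_ _
    unfold upperOrthant
    refine Integrable.fintype_prod (f := fun j t => if j ∈ B then t ^ (|s₀.re| + 1) *
      Real.exp (-(δ * t)) else Real.exp (1 - t) * Real.exp (‖w₀ j * x₀ j‖ + 1)) fun j => ?_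
    by_cases hj : j ∈ B
    · simp only [hj, if_true]
      exact integrableOn_rpow_mul_exp (by positivity) hδ
    · simp only [hj, if_false]
      refine Integrable.mul_const ?_ _
      have : IntegrableOn (fun t : ℝ => Real.exp 1 * Real.exp (-1 * t)) (Set.Ioi 1) :=
        (exp_neg_integrableOn_Ioi 1 one_pos).const_mul _
      refine this.congr_fun (fun t _ => ?_) measurableSet_Ioi
      simp only [← Real.exp_add]
      ring_nf
  · filter_upwards [ae_upperOrthant n] with y hy z hz
    obtain ⟨⟨h1, h2⟩, h3, h4⟩ := hz
    refine ⟨analyticAt_largeIntegrand a B hy fun i hi => (hη0 i hi).trans (h4 i hi y hy), ?_⟩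
    rw [largeIntegrand, norm_mul, norm_prod, norm_prod]
    refine mul_le_mul (Finset.prod_le_prod (fun _ _ => norm_nonneg _) fun j _ => ?_)
      (Finset.prod_le_prod (fun _ _ => norm_nonneg _) fun i hi =>
        norm_inv_one_sub_exp_le (hη0 i hi) (h4 i hi y hy).le)
      (Finset.prod_nonneg fun _ _ => norm_nonneg _) (Finset.prod_nonneg fun j _ => ?_)
    · split_ifs
      · have hy0 : 0 < y j := zero_lt_one.trans (hy j)
        rw [norm_mul, Complex.norm_cpow_eq_rpow_re_of_pos hy0, Complex.norm_exp]
        refine mul_le_mul (Real.rpow_le_rpow_of_exponent_le (hy j).le ?_) ?_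
          (Real.exp_pos _).le (by positivity)
        · simp only [Complex.sub_re, Complex.one_re]
          have h3' : z.1.1.re < |s₀.re| + 1 := h3
          linarith
        · rw [Real.exp_le_exp, Complex.neg_re, Complex.re_mul_ofReal]
          exact neg_le_neg (mul_le_mul_of_nonneg_right (h1 j).le hy0.le)
      · rw [norm_mul, Complex.norm_exp, Complex.norm_exp]
        refine mul_le_mul (by simp) ?_ (Real.exp_pos _).le (Real.exp_pos _).le
        rw [Real.exp_le_exp]
        refine (Complex.re_le_norm _).trans ?_
        rw [norm_neg]
        exact (h2 j).le
    · have hy0 : 0 < y j := zero_lt_one.trans (hy j)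
      split_ifs <;> positivity

theorem amplitude_integral_largeIntegrand {N n : ℕ} {a : Fin N → Fin n → ℂ} (h : HypH a)
    (B : Finset (Fin n)) :
    Amplitude fun z => ∫ y, largeIntegrand a B z y ∂(upperOrthant n) := by
  intro z hz
  obtain ⟨U, hU, bound, hb, hbd⟩ := exists_bound_largeIntegrand h B hz
  exact analyticAt_integral_of_dominated hU hb
    (fun z _ => (measurable_largeIntegrand a B z).aestronglyMeasurable) hbd

theorem integrable_largeIntegrand {N n : ℕ} {a : Fin N → Fin n → ℂ} (h : HypH a)
    (B : Finset (Fin n)) {z : (ℂ × (Fin n → ℂ)) × (Fin n → ℂ)}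
    (hz : z ∈ rightDomain n ×ˢ unitBox n) :
    Integrable (largeIntegrand a B z) (upperOrthant n) := by
  obtain ⟨U, hU, bound, hb, hbd⟩ := exists_bound_largeIntegrand h B hz
  refine hb.mono' (measurable_largeIntegrand a B z).aestronglyMeasurable ?_
  filter_upwards [hbd] with y hy
  exact (hy z (mem_of_mem_nhds hU)).2

/-- The amplitude attached to the subset `B` of large variables. -/
def largeAmplitude {N n : ℕ} (a : Fin N → Fin n → ℂ) (B : Finset (Fin n))
    (z : (ℂ × (Fin n → ℂ)) × (Fin n → ℂ)) : ℂ :=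
  (∏ i ∈ rowsVanishingOn a B, (expSlope (rowForm a i z.2))⁻¹) *
    ∫ y, largeIntegrand a B z y ∂(upperOrthant n)

theorem amplitude_largeAmplitude {N n : ℕ} {a : Fin N → Fin n → ℂ} (h : HypH a)
    (B : Finset (Fin n)) : Amplitude (largeAmplitude a B) := by
  intro z hz
  refine AnalyticAt.mul (Finset.analyticAt_fun_prod _ fun i _ => ?_)
    (amplitude_integral_largeIntegrand h B z hz)
  refine AnalyticAt.inv ?_ (h.expSlope_rowForm_ne_zero i hz.2)
  exact AnalyticAt.comp (g := expSlope)
    (f := fun z : (ℂ × (Fin n → ℂ)) × (Fin n → ℂ) => rowForm a i z.2)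
    (analyticAt_expSlope _)
    (AnalyticAt.comp (g := rowForm a i) (f := Prod.snd) (analyticAt_rowForm a i _) analyticAt_snd)

theorem integrableOn_rpow_sub_one_mul_exp {σ δ : ℝ} (hσ : 0 < σ) (hδ : 0 < δ) :
    IntegrableOn (fun t : ℝ => t ^ (σ - 1) * Real.exp (-(δ * t))) (Set.Ioi 0) := by
  have := integrableOn_rpow_mul_exp_neg_mul_rpow (p := 1) (s := σ - 1) (by linarith) one_pos hδ
  refine this.congr_fun (fun y _ => ?_) measurableSet_Ioi
  simp

theorem norm_cpow_mul_exp {s L : ℂ} {t : ℝ} (ht : 0 < t) :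
    ‖(t : ℂ) ^ (s - 1) * cexp (-(L * t))‖ = t ^ (s.re - 1) * Real.exp (-(L.re * t)) := by
  rw [norm_mul, norm_cpow_eq_rpow_re_of_pos ht, Complex.norm_exp]
  simp

theorem integrableOn_cpow_mul_exp {s L : ℂ} (hs : 0 < s.re) (hL : 0 < L.re) :
    IntegrableOn (fun t : ℝ => (t : ℂ) ^ (s - 1) * cexp (-(L * t))) (Set.Ioi 0) := by
  refine (integrableOn_rpow_sub_one_mul_exp hs hL).mono' (by fun_prop) ?_
  filter_upwards [ae_restrict_mem measurableSet_Ioi] with t ht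
  exact (norm_cpow_mul_exp ht).le

theorem integral_cpow_mul_exp {s L : ℂ} (hs : 0 < s.re) (hL : 0 < L.re) :
    ∫ t : ℝ in Set.Ioi 0, (t : ℂ) ^ (s - 1) * cexp (-(L * t)) = L ^ (-s) * Complex.Gamma s := by
  have hconv : IsPreconnected {z : ℂ | 0 < z.re} := (convex_halfSpace_re_gt 0).isPreconnected
  refine AnalyticOnNhd.eqOn_of_preconnected_of_frequently_eq (𝕜 := ℂ)
    (f := fun L : ℂ => ∫ t : ℝ in Set.Ioi 0, (t : ℂ) ^ (s - 1) * cexp (-(L * t)))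
    (g := fun L => L ^ (-s) * Complex.Gamma s) (z₀ := 1) ?_ ?_ hconv (by simp) ?_ hL
  · intro L hL
    have hL0 : 0 < L.re := hL
    refine analyticAt_integral_of_dominated (U := {z : ℂ | L.re / 2 < z.re})
      (bound := fun t => t ^ (s.re - 1) * Real.exp (-(L.re / 2 * t))) ?_
      (integrableOn_rpow_sub_one_mul_exp hs (half_pos hL0)) (fun p _ => by fun_prop) ?_
    · exact (isOpen_lt continuous_const Complex.continuous_re).mem_nhds (half_lt_self hL0)
    · filter_upwards [ae_restrict_mem measurableSet_Ioi] with t ht z hz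
      refine ⟨by fun_prop, ?_⟩
      rw [norm_cpow_mul_exp ht]
      have ht0 : 0 < t := ht
      have hz' : L.re / 2 < z.re := hz
      gcongr
  · intro L hL
    refine AnalyticAt.mul ?_ analyticAt_const
    exact analyticAt_id.cpow analyticAt_const (Or.inl hL)
  · have ht : Filter.Tendsto ((↑) : ℝ → ℂ) (nhdsWithin 1 {1}ᶜ) (nhdsWithin 1 {1}ᶜ) := by
      refine tendsto_nhdsWithin_iff.2 ⟨?_, ?_⟩
      · exact (Complex.continuous_ofReal.tendsto' 1 1 (by simp)).mono_left nhdsWithin_le_nhds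
      · filter_upwards [self_mem_nhdsWithin] with t ht
        simpa using ht
    refine ht.frequently (Filter.Eventually.frequently ?_)
    filter_upwards [mem_nhdsWithin_of_mem_nhds (eventually_gt_nhds (zero_lt_one (α := ℝ)))]
      with r hr
    rw [integral_cpow_mul_exp_neg_mul_Ioi hs hr, one_div, cpow_neg, inv_cpow _ _ ?_]
    rw [arg_ofReal_of_nonneg (le_of_lt hr)]
    exact Real.pi_pos.ne

theorem image_exp_neg_Ioi : (fun t : ℝ => Real.exp (-t)) '' Set.Ioi 0 = Set.Ioo 0 1 := by
  ext x
  constructor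
  · rintro ⟨t, ht, rfl⟩
    exact ⟨Real.exp_pos _, by simpa using ht⟩
  · rintro ⟨h0, h1⟩
    exact ⟨-Real.log x, by simpa using Real.log_neg h0 h1, by simp [Real.exp_log h0]⟩

theorem hasDerivWithinAt_exp_neg (t : ℝ) :
    HasDerivWithinAt (fun t : ℝ => Real.exp (-t)) (-Real.exp (-t)) (Set.Ioi 0) t := by
  simpa using ((hasDerivAt_id t).neg.exp).hasDerivWithinAt

theorem injOn_exp_neg : Set.InjOn (fun t : ℝ => Real.exp (-t)) (Set.Ioi 0) :=
  (Real.exp_injective.comp neg_injective).injOn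

theorem exp_neg_smul_cpow (s L : ℂ) (t : ℝ) :
    |-Real.exp (-t)| • (((Real.exp (-t) : ℝ) : ℂ) ^ (s - 1) * cexp (-(L * (Real.exp (-t) : ℝ)))) =
      cexp (-(s * t)) * cexp (-(L * cexp (-t))) := by
  have h : (Real.exp (-t) : ℂ) ≠ 0 := by exact_mod_cast (Real.exp_pos _).ne'
  rw [abs_neg, abs_of_pos (Real.exp_pos _), Complex.real_smul, ← mul_assoc]
  congr 1
  · rw [cpow_sub _ _ h, cpow_one, mul_div_cancel₀ _ h, cpow_def_of_ne_zero h,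
      ← ofReal_log (Real.exp_pos _).le, Real.log_exp, ofReal_neg, neg_mul, mul_comm]
  · rw [ofReal_exp_neg]

/-- The Mellin integral for `L ^ (-s)`, split at `1`, with `t = e^{-τ}` on `(0, 1)`. -/
theorem gamma_mul_cpow_eq {s L : ℂ} (hs : 0 < s.re) (hL : 0 < L.re) :
    Complex.Gamma s * L ^ (-s) =
      (∫ t : ℝ in Set.Ioi 1, (t : ℂ) ^ (s - 1) * cexp (-(L * t))) +
      ∫ t : ℝ in Set.Ioi 0, cexp (-(s * t)) * cexp (-(L * cexp (-t))) := by
  have hi := integrableOn_cpow_mul_exp hs hL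
  rw [mul_comm, ← integral_cpow_mul_exp hs hL, ← Set.Ioc_union_Ioi_eq_Ioi (zero_le_one (α := ℝ)),
    setIntegral_union Set.Ioc_disjoint_Ioi_same measurableSet_Ioi
      (hi.mono_set Set.Ioc_subset_Ioi_self) (hi.mono_set (Set.Ioi_subset_Ioi zero_le_one)),
    add_comm, Set.Ioc_union_Ioi_eq_Ioi (zero_le_one (α := ℝ)), integral_Ioc_eq_integral_Ioo,
    ← image_exp_neg_Ioi,
    integral_image_eq_integral_abs_deriv_smul measurableSet_Ioi
      (fun t _ => hasDerivWithinAt_exp_neg t) injOn_exp_neg]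
  simp only [exp_neg_smul_cpow]

theorem hasSum_prod_pow {𝕜 : Type*} [NormedField 𝕜] [CompleteSpace 𝕜] {N : ℕ} {q : Fin N → 𝕜}
    (h : ∀ i, ‖q i‖ < 1) : Summable (fun k : Fin N → ℕ => ‖∏ i, q i ^ k i‖) ∧
      HasSum (fun k : Fin N → ℕ => ∏ i, q i ^ k i) (∏ i, (1 - q i)⁻¹) := by
  induction N with
  | zero => exact ⟨(hasSum_fintype _).summable, by
      simp⟩
  | succ N ih =>
    obtain ⟨h1, h2⟩ := ih (q := fun i => q i.succ) fun i => h i.succ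
    have h0 : Summable fun m : ℕ => ‖q 0 ^ m‖ := by
      simpa only [norm_pow] using summable_geometric_of_lt_one (norm_nonneg _) (h 0)
    have e : ∀ x : ℕ × (Fin N → ℕ), ∏ i, q i ^ Fin.consEquiv (fun _ => ℕ) x i =
        q 0 ^ x.1 * ∏ i, q i.succ ^ x.2 i := fun x => by
      rw [Fin.prod_univ_succ]
      rfl
    have h3 := h0.mul_norm h1
    rw [← (Fin.consEquiv fun _ => ℕ).summable_iff, ← (Fin.consEquiv fun _ => ℕ).hasSum_iff,
      Fin.prod_univ_succ]
    simp only [Function.comp_def, e]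
    have h4 : HasSum (fun m : ℕ => q 0 ^ m) (1 - q 0)⁻¹ := hasSum_geometric_of_norm_lt_one (h 0)
    have h5 : Summable fun x : ℕ × (Fin N → ℕ) => q 0 ^ x.1 * ∏ i, q i.succ ^ x.2 i := h3.of_norm
    have h6 := h4.mul h2 h5
    exact ⟨h3, h6⟩

/-- The integrand whose integral over `(0, ∞)ⁿ × (1, ∞)ⁿ` is the part of
`∏ Γ(s) L_j^{-s}` in which exactly the variables indexed by `B` exceed `1`. -/
def mellinTerm {n : ℕ} (B : Finset (Fin n)) (s : ℂ) (L : Fin n → ℂ)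
    (z : (Fin n → ℝ) × (Fin n → ℝ)) : ℂ :=
  (∏ j, if j ∈ B then cexp (-z.1 j) else cexp (-(s * z.1 j)) * cexp (-(L j * cexp (-z.1 j)))) *
  ∏ j, if j ∈ B then (z.2 j : ℂ) ^ (s - 1) * cexp (-(L j * z.2 j)) else cexp (1 - z.2 j)

theorem measurable_mellinTerm {n : ℕ} (B : Finset (Fin n)) (s : ℂ) (L : Fin n → ℂ) :
    Measurable (mellinTerm B s L) := by
  unfold mellinTerm
  refine Measurable.mul (Finset.measurable_fun_prod _ fun j _ => ?_)
    (Finset.measurable_fun_prod _ fun j _ => ?_) <;> split_ifs <;> fun_prop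

theorem integral_cexp_neg_Ioi : ∫ t : ℝ in Set.Ioi 0, cexp (-t) = 1 := by
  have : ∀ t : ℝ, cexp (-t) = ((Real.exp (-t) : ℝ) : ℂ) := fun t => by simp
  simp_rw [this]
  rw [integral_complex_ofReal, integral_exp_neg_Ioi_zero, ofReal_one]

theorem integral_cexp_one_sub_Ioi : ∫ t : ℝ in Set.Ioi 1, cexp (1 - t) = 1 := by
  have : ∀ t : ℝ, cexp (1 - t) = ((Real.exp 1 * Real.exp (-t) : ℝ) : ℂ) := fun t => by
    rw [← Real.exp_add]; push_cast; ring_nf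
  simp_rw [this]
  rw [integral_complex_ofReal, integral_const_mul, integral_exp_neg_Ioi, ← Real.exp_add]
  simp

theorem sum_integral_mellinTerm {n : ℕ} {s : ℂ} {L : Fin n → ℂ} (hs : 0 < s.re)
    (hL : ∀ j, 0 < (L j).re) :
    ∑ B : Finset (Fin n), ∫ z, mellinTerm B s L z ∂((orthant n).prod (upperOrthant n)) =
      Complex.Gamma s ^ n * ∏ j, L j ^ (-s) := by
  have h : Complex.Gamma s ^ n * ∏ j, L j ^ (-s) = ∏ j, (Complex.Gamma s * L j ^ (-s)) := by
    rw [Finset.prod_mul_distrib, Finset.prod_const, Finset.card_univ, Fintype.card_fin]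
  rw [h, Finset.prod_congr rfl fun j _ => gamma_mul_cpow_eq hs (hL j), Fintype.prod_add]
  refine Finset.sum_congr rfl fun B _ => ?_
  unfold mellinTerm
  rw [integral_prod_mul
    (fun τ : Fin n → ℝ => ∏ j, if j ∈ B then cexp (-τ j) else
      cexp (-(s * τ j)) * cexp (-(L j * cexp (-τ j))))
    (fun y : Fin n → ℝ => ∏ j, if j ∈ B then (y j : ℂ) ^ (s - 1) * cexp (-(L j * y j)) else
      cexp (1 - y j))]
  unfold orthant upperOrthant
  rw [integral_fintype_prod_eq_prod (fun j (t : ℝ) => if j ∈ B then cexp (-t) else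
      cexp (-(s * t)) * cexp (-(L j * cexp (-t)))),
    integral_fintype_prod_eq_prod (fun j (t : ℝ) => if j ∈ B then
      (t : ℂ) ^ (s - 1) * cexp (-(L j * t)) else cexp (1 - t)), ← Finset.prod_mul_distrib,
    ← Finset.prod_mul_prod_compl B]
  congr 1
  · refine Finset.prod_congr rfl fun j hj => ?_
    simp only [hj, if_true, integral_cexp_neg_Ioi, one_mul]
  · refine Finset.prod_congr rfl fun j hj => ?_
    simp only [Finset.mem_compl.1 hj, if_false, integral_cexp_one_sub_Ioi, mul_one]

/-- The exponent `b` of the initial chamber attached to `B`. -/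
def initialSlope {n : ℕ} (B : Finset (Fin n)) (k : Fin n) : ℕ := if k ∈ B then 0 else 1

/-- The shift `c` of the initial chamber attached to `B`. -/
def initialShift {n : ℕ} (B : Finset (Fin n)) (k : Fin n) : ℤ := if k ∈ B then -1 else 0

theorem chamberData_initial {N n Z : ℕ} (B : Finset (Fin n)) :
    ChamberData N Z Bᶜ (initialSlope B) (initialShift B) where
  active k hk := by simp [initialSlope, initialShift, Finset.mem_compl.1 hk]
  inactive k hk := by
    have : k ∈ B := by simpa using hk
    simp [initialSlope, initialShift, this]
  card_le := by
    rw [Finset.filter_false_of_mem]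
    · simp
    · rintro k - ⟨hk, hk'⟩
      have : k ∈ B := by simpa using hk
      simp [initialSlope, this] at hk'

/-- The integrand in the small variables attached to `B`. -/
def smallIntegrand {N n : ℕ} (a : Fin N → Fin n → ℂ) (B : Finset (Fin n))
    (p : ℂ × (Fin n → ℂ)) : (Fin n → ℝ) → ℂ :=
  kernel (affineExp (initialSlope B) (initialShift B) p.1) fun x =>
    (∏ i ∈ rowsVanishingOn a B, (rowForm a i x)⁻¹) * largeAmplitude a B (p, x)

/-- The sum over `k` of `mellinTerm B s (w + ∑ i, k_i a_i)`. -/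
def mellinSum {N n : ℕ} (a : Fin N → Fin n → ℂ) (B : Finset (Fin n)) (p : ℂ × (Fin n → ℂ))
    (z : (Fin n → ℝ) × (Fin n → ℝ)) : ℂ :=
  mellinTerm B p.1 p.2 z * ∏ i, (1 - cexp (-rowForm a i (mix B z.2 (expNeg z.1))))⁻¹

theorem mellinTerm_eq {n : ℕ} (B : Finset (Fin n)) (s : ℂ) (L : Fin n → ℂ)
    (z : (Fin n → ℝ) × (Fin n → ℝ)) : mellinTerm B s L z =
      (∏ j, if j ∈ B then cexp (-z.1 j) * (z.2 j : ℂ) ^ (s - 1) else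
        cexp (-(s * z.1 j)) * cexp (1 - z.2 j)) *
      cexp (-∑ j, L j * mix B z.2 (expNeg z.1) j) := by
  rw [← Finset.sum_neg_distrib, Complex.exp_sum, ← Finset.prod_mul_distrib, mellinTerm,
    ← Finset.prod_mul_distrib]
  refine Finset.prod_congr rfl fun j _ => ?_
  by_cases hj : j ∈ B
  · simp only [hj, if_true, mix]; ring
  · simp only [hj, if_false, mix, expNeg]; ring

theorem mellinTerm_add {N n : ℕ} (a : Fin N → Fin n → ℂ) (B : Finset (Fin n)) (s : ℂ)
    (w : Fin n → ℂ) (k : Fin N → ℕ) (z : (Fin n → ℝ) × (Fin n → ℝ)) :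
    mellinTerm B s (fun j => w j + ∑ i, (k i : ℂ) * a i j) z =
      mellinTerm B s w z * ∏ i, cexp (-rowForm a i (mix B z.2 (expNeg z.1))) ^ k i := by
  rw [mellinTerm_eq, mellinTerm_eq, mul_assoc]
  congr 1
  simp only [← Complex.exp_nat_mul]
  rw [← Complex.exp_sum, ← Complex.exp_add]
  congr 1
  simp only [mul_neg, Finset.sum_neg_distrib, add_mul, Finset.sum_add_distrib, neg_add]
  congr 2
  simp only [rowForm, Finset.mul_sum, Finset.sum_mul]
  rw [Finset.sum_comm]
  refine Finset.sum_congr rfl fun i _ => Finset.sum_congr rfl fun j _ => by ring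

theorem rowForm_mix {N n : ℕ} {a : Fin N → Fin n → ℂ} {B : Finset (Fin n)} {i : Fin N}
    (hi : i ∈ rowsVanishingOn a B) (y : Fin n → ℝ) (x : Fin n → ℂ) :
    rowForm a i (mix B y x) = rowForm a i x := by
  have h : ∀ j ∈ B, a i j = 0 := by simpa [rowsVanishingOn] using hi
  refine Finset.sum_congr rfl fun j _ => ?_
  by_cases hj : j ∈ B
  · simp [h j hj]
  · simp [mix, hj]

theorem mellinSum_eq {N n : ℕ} (a : Fin N → Fin n → ℂ) (B : Finset (Fin n))
    (p : ℂ × (Fin n → ℂ)) (τ y : Fin n → ℝ) : mellinSum a B p (τ, y) =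
      cexp (-∑ k, affineExp (initialSlope B) (initialShift B) p.1 k * τ k) *
      ((∏ i ∈ rowsVanishingOn a B, (rowForm a i (expNeg τ))⁻¹) *
      (∏ i ∈ rowsVanishingOn a B, (expSlope (rowForm a i (expNeg τ)))⁻¹)) *
      largeIntegrand a B (p, expNeg τ) y := by
  have h1 : ∏ i, (1 - cexp (-rowForm a i (mix B y (expNeg τ))))⁻¹ =
      ((∏ i ∈ rowsVanishingOn a B, (rowForm a i (expNeg τ))⁻¹) *
      (∏ i ∈ rowsVanishingOn a B, (expSlope (rowForm a i (expNeg τ)))⁻¹)) *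
      ∏ i ∈ (rowsVanishingOn a B)ᶜ, (1 - cexp (-rowForm a i (mix B y (expNeg τ))))⁻¹ := by
    rw [← Finset.prod_mul_prod_compl (rowsVanishingOn a B), ← Finset.prod_mul_distrib]
    congr 1
    refine Finset.prod_congr rfl fun i hi => ?_
    rw [rowForm_mix hi, inv_one_sub_exp]
  have h2 : mellinTerm B p.1 p.2 (τ, y) =
      cexp (-∑ k, affineExp (initialSlope B) (initialShift B) p.1 k * τ k) *
      ∏ j, if j ∈ B then (y j : ℂ) ^ (p.1 - 1) * cexp (-(p.2 j * y j))
        else cexp (1 - y j) * cexp (-(p.2 j * expNeg τ j)) := by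
    rw [← Finset.sum_neg_distrib, Complex.exp_sum, mellinTerm, ← Finset.prod_mul_distrib,
      ← Finset.prod_mul_distrib]
    refine Finset.prod_congr rfl fun j _ => ?_
    by_cases hj : j ∈ B
    · simp [hj, affineExp, initialSlope, initialShift]
    · simp only [hj, if_false, affineExp, initialSlope, initialShift, expNeg]
      push_cast
      ring_nf
  rw [mellinSum, h1, h2, largeIntegrand]
  ring

theorem integral_mellinSum {N n : ℕ} (a : Fin N → Fin n → ℂ) (B : Finset (Fin n))
    (p : ℂ × (Fin n → ℂ)) (τ : Fin n → ℝ) :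
    ∫ y, mellinSum a B p (τ, y) ∂(upperOrthant n) = smallIntegrand a B p τ := by
  simp only [mellinSum_eq]
  rw [integral_const_mul, smallIntegrand, kernel, largeAmplitude]
  ring

theorem measurable_mellinSum {N n : ℕ} (a : Fin N → Fin n → ℂ) (B : Finset (Fin n))
    (p : ℂ × (Fin n → ℂ)) : Measurable (mellinSum a B p) := by
  unfold mellinSum
  refine (measurable_mellinTerm B p.1 p.2).mul (Finset.measurable_fun_prod _ fun i _ => ?_)
  refine Measurable.inv (Measurable.sub measurable_const (Measurable.cexp (Measurable.neg ?_)))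
  unfold rowForm mix expNeg
  refine Finset.measurable_fun_sum _ fun j _ => Measurable.mul measurable_const ?_
  split_ifs <;> fun_prop

theorem integrable_mellinSum_right {N n : ℕ} {a : Fin N → Fin n → ℂ} (ha : HypH a)
    (B : Finset (Fin n)) {p : ℂ × (Fin n → ℂ)} (hp : p ∈ rightDomain n) :
    ∀ᵐ τ ∂(orthant n), Integrable (fun y => mellinSum a B p (τ, y)) (upperOrthant n) := by
  filter_upwards [ae_orthant_pos n] with τ hτ
  simp only [mellinSum_eq]
  exact (integrable_largeIntegrand ha B ⟨hp, expNeg_mem fun k => (hτ k).le⟩).const_mul _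

theorem ae_prod_pos (n : ℕ) : ∀ᵐ z ∂((orthant n).prod (upperOrthant n)),
    (∀ k, 0 < z.1 k) ∧ ∀ k, 1 < z.2 k := by
  filter_upwards [Measure.quasiMeasurePreserving_fst.ae (ae_orthant_pos n),
    Measure.quasiMeasurePreserving_snd.ae (ae_upperOrthant n)] with z h1 h2
  exact ⟨h1, h2⟩

/-- The matrix of real parts. -/
def reMat {N n : ℕ} (a : Fin N → Fin n → ℂ) : Fin N → Fin n → ℂ := fun i j => ((a i j).re : ℂ)

/-- The point with the real parts of `s` and `w`. -/
def rePoint {n : ℕ} (p : ℂ × (Fin n → ℂ)) : ℂ × (Fin n → ℂ) := (p.1.re, fun k => (p.2 k).re)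

theorem HypH.reMat_eq_zero_iff {N n : ℕ} {a : Fin N → Fin n → ℂ} (ha : HypH a) (i : Fin N)
    (j : Fin n) : reMat a i j = 0 ↔ a i j = 0 := by
  rcases ha.1 i j with h | h
  · simp [reMat, h]
  · refine ⟨fun h0 => absurd (ofReal_eq_zero.1 h0) h.ne', fun h0 => by simp [reMat, h0]⟩

theorem HypH.reMat {N n : ℕ} {a : Fin N → Fin n → ℂ} (ha : HypH a) : HypH (reMat a) := by
  refine ⟨fun i j => ?_, fun i => ?_⟩
  · rw [ha.reMat_eq_zero_iff]
    exact ha.1 i j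
  · obtain ⟨j, hj⟩ := ha.2 i
    exact ⟨j, mt (ha.reMat_eq_zero_iff i j).1 hj⟩

theorem rePoint_mem {n : ℕ} {p : ℂ × (Fin n → ℂ)} (hp : p ∈ rightDomain n) :
    rePoint p ∈ rightDomain n := hp

theorem norm_mellinTerm {n : ℕ} (B : Finset (Fin n)) (s : ℂ) (L : Fin n → ℂ)
    {z : (Fin n → ℝ) × (Fin n → ℝ)} (hz : ∀ k, 0 < z.2 k) :
    (‖mellinTerm B s L z‖ : ℂ) = mellinTerm B (s.re : ℂ) (fun j => ((L j).re : ℂ)) z := by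
  rw [mellinTerm, norm_mul, norm_prod, norm_prod, ofReal_mul, ofReal_prod, ofReal_prod, mellinTerm]
  have he : ∀ t : ℝ, cexp (-t) = ((Real.exp (-t) : ℝ) : ℂ) := fun t => by simp
  congr 1 <;> refine Finset.prod_congr rfl fun j _ => ?_
  · split_ifs
    · simp [Complex.norm_exp]
    · rw [he, norm_mul, Complex.norm_exp, Complex.norm_exp]
      simp only [Complex.neg_re, Complex.re_mul_ofReal]
      push_cast
      ring_nf
  · split_ifs
    · rw [norm_mul, norm_cpow_eq_rpow_re_of_pos (hz j), Complex.norm_exp, ofReal_mul,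
        ofReal_cpow (hz j).le]
      simp
    · simp [Complex.norm_exp]

theorem exists_real_mix {n : ℕ} (B : Finset (Fin n)) {z : (Fin n → ℝ) × (Fin n → ℝ)}
    (hz : ∀ k, 0 < z.2 k) :
    ∃ X : Fin n → ℝ, (∀ j, 0 < X j) ∧ mix B z.2 (expNeg z.1) = fun j => (X j : ℂ) := by
  refine ⟨fun j => if j ∈ B then z.2 j else Real.exp (-z.1 j), fun j => ?_, ?_⟩
  · dsimp only
    split_ifs
    · exact hz j
    · exact Real.exp_pos _
  · funext j
    by_cases hj : j ∈ B <;> simp [mix, expNeg, hj]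

theorem re_rowForm_ofReal {N n : ℕ} (a : Fin N → Fin n → ℂ) (i : Fin N) (X : Fin n → ℝ) :
    ((rowForm a i fun j => (X j : ℂ)).re : ℂ) = rowForm (reMat a) i fun j => (X j : ℂ) := by
  simp [rowForm, reMat, Complex.re_sum]

theorem HypH.re_rowForm_mix_pos {N n : ℕ} {a : Fin N → Fin n → ℂ} (ha : HypH a)
    (B : Finset (Fin n)) {z : (Fin n → ℝ) × (Fin n → ℝ)} (hz : ∀ k, 0 < z.2 k) (i : Fin N) :
    0 < (rowForm a i (mix B z.2 (expNeg z.1))).re := by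
  obtain ⟨X, hX, h⟩ := exists_real_mix B hz
  obtain ⟨j, hj⟩ := ha.2 i
  rw [h, rowForm, Complex.re_sum]
  refine Finset.sum_pos' (fun k _ => ?_) ⟨j, Finset.mem_univ _, ?_⟩
  · rw [Complex.re_mul_ofReal]
    exact mul_nonneg (ha.re_nonneg i k) (hX k).le
  · rw [Complex.re_mul_ofReal]
    exact mul_pos ((ha.1 i j).resolve_left hj) (hX j)

/-- The sum over `k` of the absolute values of `mellinTerm B s (w + ∑ i, k_i a_i)`. -/
def mellinMajorant {N n : ℕ} (a : Fin N → Fin n → ℂ) (B : Finset (Fin n)) (p : ℂ × (Fin n → ℂ))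
    (z : (Fin n → ℝ) × (Fin n → ℝ)) : ℝ :=
  ‖mellinTerm B p.1 p.2 z‖ *
    ∏ i, (1 - Real.exp (-(rowForm a i (mix B z.2 (expNeg z.1))).re))⁻¹

theorem ofReal_mellinMajorant {N n : ℕ} (a : Fin N → Fin n → ℂ) (B : Finset (Fin n))
    (p : ℂ × (Fin n → ℂ)) {z : (Fin n → ℝ) × (Fin n → ℝ)} (hz : ∀ k, 0 < z.2 k) :
    (mellinMajorant a B p z : ℂ) = mellinSum (reMat a) B (rePoint p) z := by
  obtain ⟨X, -, h⟩ := exists_real_mix B hz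
  rw [mellinMajorant, mellinSum, ofReal_mul, norm_mellinTerm B _ _ hz, ofReal_prod, h]
  simp only [← re_rowForm_ofReal]
  push_cast
  rfl

theorem mellinMajorant_nonneg {N n : ℕ} {a : Fin N → Fin n → ℂ} (ha : HypH a)
    (B : Finset (Fin n)) (p : ℂ × (Fin n → ℂ)) {z : (Fin n → ℝ) × (Fin n → ℝ)}
    (hz : ∀ k, 0 < z.2 k) : 0 ≤ mellinMajorant a B p z := by
  refine mul_nonneg (norm_nonneg _) (Finset.prod_nonneg fun i _ => inv_nonneg.2 ?_)
  simpa using (ha.re_rowForm_mix_pos B hz i).le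

theorem integrable_mellinMajorant {N n : ℕ} {a : Fin N → Fin n → ℂ} (ha : HypH a)
    (B : Finset (Fin n)) {p : ℂ × (Fin n → ℂ)} (hp : p ∈ rightDomain n)
    (hI : Integrable (smallIntegrand (reMat a) B (rePoint p)) (orthant n)) :
    Integrable (mellinMajorant a B p) ((orthant n).prod (upperOrthant n)) := by
  have hr := integrable_mellinSum_right ha.reMat B (rePoint_mem hp)
  have h : Integrable (mellinSum (reMat a) B (rePoint p)) ((orthant n).prod (upperOrthant n)) := by
    refine (integrable_prod_iff (measurable_mellinSum _ _ _).aestronglyMeasurable).2 ⟨hr, ?_⟩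
    refine hI.re.congr ?_
    filter_upwards [hr] with τ hτ
    rw [← integral_mellinSum, ← integral_re hτ]
    refine integral_congr_ae ?_
    filter_upwards [ae_upperOrthant n] with y hy
    have hy0 : ∀ k, 0 < ((τ, y) : (Fin n → ℝ) × (Fin n → ℝ)).2 k :=
      fun k => zero_lt_one.trans (hy k)
    rw [← ofReal_mellinMajorant a B p hy0, norm_real, Real.norm_of_nonneg
      (mellinMajorant_nonneg ha B p hy0)]
    exact ofReal_re _
  refine h.re.congr ?_
  filter_upwards [ae_prod_pos n] with z hz
  rw [← ofReal_mellinMajorant a B p fun k => zero_lt_one.trans (hz.2 k)]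
  exact ofReal_re _

theorem norm_mellinSum_le {N n : ℕ} {a : Fin N → Fin n → ℂ} (ha : HypH a)
    (B : Finset (Fin n)) (p : ℂ × (Fin n → ℂ)) {z : (Fin n → ℝ) × (Fin n → ℝ)}
    (hz : ∀ k, 0 < z.2 k) : ‖mellinSum a B p z‖ ≤ mellinMajorant a B p z := by
  rw [mellinSum, norm_mul, norm_prod]
  exact mul_le_mul_of_nonneg_left (Finset.prod_le_prod (fun _ _ => norm_nonneg _) fun i _ =>
    norm_inv_one_sub_exp_le (ha.re_rowForm_mix_pos B hz i) le_rfl) (norm_nonneg _)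

theorem hasSum_integral_mellinTerm {N n : ℕ} {a : Fin N → Fin n → ℂ} (ha : HypH a)
    (B : Finset (Fin n)) {p : ℂ × (Fin n → ℂ)} (hp : p ∈ rightDomain n)
    (hI : Integrable (smallIntegrand (reMat a) B (rePoint p)) (orthant n)) :
    HasSum (fun k : Fin N → ℕ => ∫ z, mellinTerm B p.1 (fun j => p.2 j + ∑ i, (k i : ℂ) * a i j) z
        ∂((orthant n).prod (upperOrthant n)))
      (∫ τ, smallIntegrand a B p τ ∂(orthant n)) := by
  have hM := integrable_mellinMajorant ha B hp hI
  have hpos := ae_prod_pos n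
  have hi : Integrable (mellinSum a B p) ((orthant n).prod (upperOrthant n)) := by
    refine hM.mono' (measurable_mellinSum a B p).aestronglyMeasurable ?_
    filter_upwards [hpos] with z hz
    exact norm_mellinSum_le ha B p fun k => zero_lt_one.trans (hz.2 k)
  have hb : ∀ᵐ z ∂((orthant n).prod (upperOrthant n)), HasSum (fun k : Fin N → ℕ =>
      ‖mellinTerm B p.1 p.2 z‖ *
        ∏ i, Real.exp (-(rowForm a i (mix B z.2 (expNeg z.1))).re) ^ k i)
      (mellinMajorant a B p z) := by
    filter_upwards [hpos] with z hz
    have hq : ∀ i, ‖Real.exp (-(rowForm a i (mix B z.2 (expNeg z.1))).re)‖ < 1 := fun i => by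
      rw [Real.norm_of_nonneg (Real.exp_pos _).le, Real.exp_lt_one_iff, neg_lt_zero]
      exact ha.re_rowForm_mix_pos B (fun k => zero_lt_one.trans (hz.2 k)) i
    have hs := (hasSum_prod_pow hq).2.mul_left ‖mellinTerm B p.1 p.2 z‖
    exact hs
  simp only [← integral_mellinSum]
  rw [← integral_prod _ hi]
  refine hasSum_integral_of_dominated_convergence (fun k z => ‖mellinTerm B p.1 p.2 z‖ *
        ∏ i, Real.exp (-(rowForm a i (mix B z.2 (expNeg z.1))).re) ^ k i)
    (fun k => (measurable_mellinTerm _ _ _).aestronglyMeasurable) (fun k => ?_) ?_ ?_ ?_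
  · refine Filter.Eventually.of_forall fun z => ?_
    rw [mellinTerm_add, norm_mul, norm_prod]
    simp only [norm_pow, Complex.norm_exp, Complex.neg_re, le_refl]
  · filter_upwards [hb] with z hz using hz.summable
  · refine hM.congr ?_
    filter_upwards [hb] with z hz using hz.tsum_eq.symm
  · filter_upwards [hpos] with z hz
    simp only [mellinTerm_add]
    have hq : ∀ i, ‖cexp (-rowForm a i (mix B z.2 (expNeg z.1)))‖ < 1 := fun i => by
      rw [Complex.norm_exp, Real.exp_lt_one_iff, Complex.neg_re, neg_lt_zero]
      exact ha.re_rowForm_mix_pos B (fun k => zero_lt_one.trans (hz.2 k)) i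
    have hs := (hasSum_prod_pow hq).2.mul_left (mellinTerm B p.1 p.2 z)
    exact hs

/-- Continuation of `Γ(s)ⁿ ζ(s, w)`. -/
theorem exists_continuation_gamma_mul_zetaSeries {N n Z : ℕ} (hZ : Z < n)
    {a : Fin N → Fin n → ℂ} (ha : HypH a)
    (hrow : ∀ i, (Finset.univ.filter fun j => a i j = 0).card ≤ Z) :
    ∃ H : ℂ × (Fin n → ℂ) → ℂ, HasPermittedPoles N n Z H ∧ ∀ p ∈ rightDomain n,
      (N : ℝ) / ((n : ℝ) - (Z : ℝ)) < p.1.re →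
      H p = Complex.Gamma p.1 ^ n * zetaSeries a p.1 p.2 := by
  have key : ∀ {a : Fin N → Fin n → ℂ} (_ : HypH a)
      (_ : ∀ i, (Finset.univ.filter fun j => a i j = 0).card ≤ Z) (B : Finset (Fin n)),
      ∃ H : ℂ × (Fin n → ℂ) → ℂ, HasPermittedPoles N n Z H ∧ ∀ p ∈ rightDomain n,
        (N : ℝ) / ((n : ℝ) - (Z : ℝ)) < p.1.re →
        Integrable (smallIntegrand a B p) (orthant n) ∧
          H p = ∫ τ, smallIntegrand a B p τ ∂(orthant n) := by
    intro a ha hrow B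
    refine exists_continuation_of_rows hZ ha hrow _ Bᶜ (rowsVanishingOn a B) _ _
      (largeAmplitude a B) rfl (chamberData_initial B) ?_ (amplitude_largeAmplitude ha B)
    intro i hi k hk
    rw [Finset.mem_compl]
    intro hkB
    simp only [rowsVanishingOn, Finset.mem_filter, Finset.mem_univ, true_and] at hi
    exact hk (hi k hkB)
  choose H hH hHp using key ha hrow
  refine ⟨fun p => ∑ B, H B p, .sum _ fun B _ => hH B, fun p hp hs => ?_⟩
  have hs0 : 0 < p.1.re := by
    have : (0 : ℝ) < (n : ℝ) - Z := sub_pos.2 (by exact_mod_cast hZ)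
    exact lt_of_le_of_lt (by positivity) hs
  have hre : ∀ B, Integrable (smallIntegrand (reMat a) B (rePoint p)) (orthant n) := fun B => by
    obtain ⟨_, -, h⟩ := key ha.reMat (fun i => by
      simpa only [ha.reMat_eq_zero_iff] using hrow i) B
    exact (h (rePoint p) (rePoint_mem hp) (by simpa [rePoint] using hs)).1
  have hsum := hasSum_sum fun B (_ : B ∈ Finset.univ) => hasSum_integral_mellinTerm ha B hp (hre B)
  simp only [← (hHp _ p hp hs).2] at hsum
  dsimp only
  rw [← hsum.tsum_eq, zetaSeries, ← tsum_mul_left]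
  refine tsum_congr fun k => sum_integral_mellinTerm hs0 fun j => ?_
  rw [Complex.add_re, Complex.re_sum]
  refine add_pos_of_pos_of_nonneg (hp j) (Finset.sum_nonneg fun i _ => ?_)
  rw [← ofReal_natCast, Complex.re_ofReal_mul]
  exact mul_nonneg (Nat.cast_nonneg _) (ha.re_nonneg i j)

theorem analyticAt_inv_Gamma (s : ℂ) : AnalyticAt ℂ (fun s => (Complex.Gamma s)⁻¹) s :=
  Complex.differentiable_one_div_Gamma.analyticAt s

theorem isOpen_ne_neg_nat : IsOpen {s : ℂ | ∀ l : ℕ, s ≠ -l} := by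
  have h : {s : ℂ | ∀ l : ℕ, s ≠ -l} = (fun s => (Complex.Gamma s)⁻¹) ⁻¹' {0}ᶜ := by
    ext s
    simp [Complex.Gamma_eq_zero_iff]
  rw [h]
  exact isOpen_compl_singleton.preimage Complex.differentiable_one_div_Gamma.continuous

theorem exists_inv_Gamma_eq (l : ℕ) : ∃ g : ℂ → ℂ, AnalyticAt ℂ g (-l) ∧
    ∀ s, (Complex.Gamma s)⁻¹ = (s - -l) * g s := by
  refine ⟨dslope (fun s => (Complex.Gamma s)⁻¹) (-l), ?_, fun s => ?_⟩
  · have h : Differentiable ℂ (dslope (fun s => (Complex.Gamma s)⁻¹) (-l)) := by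
      rw [← differentiableOn_univ, Complex.differentiableOn_dslope Filter.univ_mem,
        differentiableOn_univ]
      exact Complex.differentiable_one_div_Gamma
    exact h.analyticAt _
  · have h := sub_smul_dslope (fun s => (Complex.Gamma s)⁻¹) (-l : ℂ) s
    rw [smul_eq_mul] at h
    rw [h, Complex.Gamma_neg_nat_eq_zero]
    simp

theorem eventually_ne_neg_nat (l : ℕ) :
    ∀ᶠ s in nhds (-(l : ℂ)), s ≠ -(l : ℂ) → ∀ m : ℕ, s ≠ -(m : ℂ) := by
  filter_upwards [Metric.ball_mem_nhds (-(l : ℂ)) one_pos] with s hs hne m hm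
  refine hne (hm.trans ?_)
  have hcast : (m : ℂ) - l = ((m - l : ℤ) : ℂ) := by push_cast; rfl
  rw [Metric.mem_ball, hm, dist_neg_neg, Complex.dist_eq, hcast, Complex.norm_intCast,
    ← Int.cast_abs] at hs
  have : |(m : ℤ) - l| < 1 := by exact_mod_cast hs
  have : m = l := by rw [Int.abs_lt_one_iff] at this; omega
  rw [this]

/-- Replace the values of `F` at the non-positive integers by limits in `s`. -/
def fillNegNat {W : Type} (F : ℂ × W → ℂ) (p : ℂ × W) : ℂ :=
  if ∃ l : ℕ, p.1 = -l then Filter.limUnder (nhdsWithin p.1 {p.1}ᶜ) fun s => F (s, p.2) else F p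

theorem fillNegNat_of_ne {W : Type} {F : ℂ × W → ℂ} {p : ℂ × W} (hp : ∀ l : ℕ, p.1 ≠ -l) :
    fillNegNat F p = F p := if_neg (by simpa using hp)

theorem fillNegNat_eventuallyEq {W : Type} [NormedAddCommGroup W] {F : ℂ × W → ℂ} {p : ℂ × W}
    (hp : ∀ l : ℕ, p.1 ≠ -l) : ∀ᶠ q in nhds p, fillNegNat F q = F q := by
  filter_upwards [(continuous_fst.tendsto p).eventually (isOpen_ne_neg_nat.mem_nhds hp)] with q hq
  exact fillNegNat_of_ne hq

theorem analyticAt_fillNegNat {W : Type} [NormedAddCommGroup W] [NormedSpace ℂ W]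
    {F A : ℂ × W → ℂ} {l : ℕ} {w : W} (hA : AnalyticAt ℂ A (-(l : ℂ), w))
    (h : ∀ᶠ p in nhds (-(l : ℂ), w), p.1 ≠ -(l : ℂ) → F p = A p) :
    AnalyticAt ℂ (fillNegNat F) (-(l : ℂ), w) := by
  refine hA.congr ?_
  filter_upwards [hA.eventually_analyticAt, h.eventually_nhds,
    (continuous_fst.tendsto (-(l : ℂ), w)).eventually (eventually_ne_neg_nat l)] with p h1 h2 h3
  by_cases hp : p.1 = -(l : ℂ)
  · rw [fillNegNat, if_pos ⟨l, hp⟩]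
    refine (Filter.Tendsto.limUnder_eq ?_).symm
    have hc : Filter.Tendsto (fun s : ℂ => (s, p.2)) (nhds p.1) (nhds p) :=
      (Continuous.prodMk_left p.2).tendsto p.1
    refine (Filter.Tendsto.mono_left (h1.continuousAt.tendsto.comp hc) nhdsWithin_le_nhds).congr' ?_
    filter_upwards [mem_nhdsWithin_of_mem_nhds (hc.eventually h2), self_mem_nhdsWithin] with s hs hs'
    exact (hs (by rw [← hp]; exact hs')).symm
  · rw [fillNegNat_of_ne (h3 hp), h2.self_of_nhds hp]

theorem analyticAt_slice {W : Type} [NormedAddCommGroup W] [NormedSpace ℂ W] {F : ℂ × W → ℂ}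
    {s : ℂ} {w : W} (h : AnalyticAt ℂ F (s, w)) : AnalyticAt ℂ (fun s => F (s, w)) s :=
  AnalyticAt.comp (g := F) (f := fun s => (s, w)) h (analyticAt_id.prod analyticAt_const)

theorem HasPoleOrderAt.analyticAt_pow_mul {W : Type} [NormedAddCommGroup W] [NormedSpace ℂ W]
    {F : ℂ × W → ℂ} {s₀ : ℂ} {w : W} {M : ℕ} (h : HasPoleOrderAt M F (s₀, w)) :
    AnalyticAt ℂ (fun s => (s - s₀) ^ (M + 1) * F (s, w)) s₀ := by
  obtain ⟨g, hg, he⟩ := h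
  refine ((analyticAt_id.sub (analyticAt_const (v := s₀))).mul (analyticAt_slice hg)).congr ?_
  filter_upwards [((Continuous.prodMk_left w).tendsto s₀).eventually he] with s hs
  by_cases hne : s = s₀
  · simp [hne]
  · simp only [Pi.mul_apply, Pi.sub_apply, id]
    rw [← hs (Or.inl hne), pow_succ', mul_assoc]

/-- Proposition 2: `ζ_{N,n}(s,w,M)` has a meromorphic continuation to
`ℂ × {w | Re w_k > 0}`; for fixed `w`, poles in `s` have order at most `Z+1`
(expressed by analyticity of `(s-s₀)^{Z+2}·F`), occur only at real rationals
`a/b ≤ N/(n-Z)` with `n-Z ≤ b ≤ n`, and the continuation is analytic at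
`(-ℓ, w)` for every non-negative integer `ℓ`. -/
theorem zetaSeries_meromorphic_continuation {N n : ℕ} (hN : 0 < N) (hn : 0 < n)
    (a : Fin N → Fin n → ℂ) (hH : HypH a) (Z : ℕ) (hZn : Z < n)
    (hrow : ∀ i, ((Finset.univ.filter fun j => a i j = 0).card ≤ Z)) :
    ∃ F : ℂ × (Fin n → ℂ) → ℂ,
      (∀ (s : ℂ) (w : Fin n → ℂ), (N : ℝ) / ((n : ℝ) - (Z : ℝ)) < s.re →
        (∀ k, 0 < (w k).re) → F (s, w) = zetaSeries a s w) ∧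
      (∀ w : Fin n → ℂ, (∀ k, 0 < (w k).re) →
        MeromorphicOn (fun s => F (s, w)) Set.univ ∧
        (∀ s₀ : ℂ, ¬ AnalyticAt ℂ (fun s => F (s, w)) s₀ →
          s₀.im = 0 ∧ s₀.re ≤ (N : ℝ) / ((n : ℝ) - (Z : ℝ)) ∧
          ∃ A B : ℤ, (n : ℤ) - (Z : ℤ) ≤ B ∧ B ≤ (n : ℤ) ∧ s₀ = (A : ℂ) / (B : ℂ)) ∧
        (∀ s₀ : ℂ, AnalyticAt ℂ (fun s => (s - s₀) ^ (Z + 2) * F (s, w)) s₀)) ∧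
      (∀ (l : ℕ) (w : Fin n → ℂ), (∀ k, 0 < (w k).re) →
        AnalyticAt ℂ F (-(l : ℂ), w)) := by
  obtain ⟨H, hH1, hH2⟩ := exists_continuation_gamma_mul_zetaSeries hZn hH hrow
  set F₀ : ℂ × (Fin n → ℂ) → ℂ := fun p => (Complex.Gamma p.1)⁻¹ ^ n * H p with hF₀
  have hΓ : ∀ p : ℂ × (Fin n → ℂ), HasPoleOrderAt 0
      (fun p : ℂ × (Fin n → ℂ) => (Complex.Gamma p.1)⁻¹ ^ n) p := fun p =>
    .of_analyticAt ((AnalyticAt.comp (g := fun s => (Complex.Gamma s)⁻¹) (f := Prod.fst)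
      (analyticAt_inv_Gamma _) analyticAt_fst).pow n)
  have hmul : ∀ {M : ℕ} {p : ℂ × (Fin n → ℂ)}, (∀ l : ℕ, p.1 ≠ -l) → HasPoleOrderAt M H p →
      HasPoleOrderAt M (fillNegNat F₀) p := fun {M p} hp h => by
    have := (hΓ p).mul h
    rw [zero_add] at this
    exact this.congr (fillNegNat_eventuallyEq hp)
  have hneg : ∀ (l : ℕ) (w : Fin n → ℂ), (∀ k, 0 < (w k).re) →
      AnalyticAt ℂ (fillNegNat F₀) (-(l : ℂ), w) := fun l w hw => by
    obtain ⟨h, hh, he⟩ := (hH1 (-(l : ℂ), w) hw).1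
    obtain ⟨g, hg, hgΓ⟩ := exists_inv_Gamma_eq l
    refine analyticAt_fillNegNat (A := fun p => g p.1 ^ n * h p)
      (((AnalyticAt.comp (g := g) (f := Prod.fst) hg analyticAt_fst).pow n).mul hh) ?_
    filter_upwards [he] with p hp hne
    rw [hF₀, ← hp (Or.inl hne)]
    dsimp only
    rw [hgΓ, mul_pow]
    ring
  have hpow : ∀ w : Fin n → ℂ, (∀ k, 0 < (w k).re) → ∀ s₀ : ℂ,
      AnalyticAt ℂ (fun s => (s - s₀) ^ (Z + 2) * fillNegNat F₀ (s, w)) s₀ := fun w hw s₀ => by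
    by_cases hs : ∃ l : ℕ, s₀ = -l
    · obtain ⟨l, rfl⟩ := hs
      exact ((analyticAt_id.sub analyticAt_const).pow _).mul (analyticAt_slice (hneg l w hw))
    · push Not at hs
      exact (hmul hs ((hH1 (s₀, w) hw).2 hs).1).analyticAt_pow_mul
  refine ⟨fillNegNat F₀, fun s w hs hw => ?_, fun w hw => ⟨fun s₀ _ => ⟨Z + 2, hpow w hw s₀⟩,
    fun s₀ hs₀ => ?_, hpow w hw⟩, hneg⟩
  · have hs0 : 0 < s.re := by
      have : (0 : ℝ) < (n : ℝ) - Z := sub_pos.2 (by exact_mod_cast hZn)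
      exact lt_of_le_of_lt (by positivity) hs
    have hne : ∀ l : ℕ, s ≠ -l := fun l hl => by
      rw [hl, Complex.neg_re, Complex.natCast_re] at hs0
      have : (0 : ℝ) ≤ l := Nat.cast_nonneg l
      linarith
    rw [fillNegNat_of_ne (p := (s, w)) hne, hF₀]
    dsimp only
    rw [hH2 (s, w) hw hs, ← mul_assoc, ← mul_pow, inv_mul_cancel₀ (Complex.Gamma_ne_zero hne),
      one_pow, one_mul]
  · by_cases hs : ∃ l : ℕ, s₀ = -l
    · obtain ⟨l, rfl⟩ := hs
      exact absurd (analyticAt_slice (hneg l w hw)) hs₀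
    · push Not at hs
      by_contra hperm
      exact hs₀ (analyticAt_slice (hmul hs (((hH1 (s₀, w) hw).2 hs).2 hperm)).analyticAt)
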